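/- arXiv:2004.05057 — 4 statements merged into one kernel-verified Lean document; each statement's English description precedes it below -/
import Mathlib

section
/- Let T be a random pseudometric on ℝ^d that is ergodic and has finite moments. Then there exists a time constant for T, i.e. a function μ : ℝ^d → [0,∞) satisfying μ(t·x) = |t|·μ(x) for every rational t and every x ∈ ℝ^d and μ(x+y) ≤ μ(x)+μ(y) for all x,y, such that for every v ∈ ℝ^d the rescaled passage times T(0, n·v)/n converge to μ(v) as n → ∞ (n ∈ ℕ), both almost surely and in L¹. If moreover the law of T is invariant under the orthogonal group O(d) acting by (ρ·T)(x,y) = T(ρx, ρy), then μ is constant on the Euclidean unit sphere. -/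
open MeasureTheory Filter Set Metric

noncomputable section

abbrev Rd (d : ℕ) := EuclideanSpace ℝ (Fin d)

def IsPseudometric {d : ℕ} (T : Rd d × Rd d → ℝ) : Prop :=
  (∀ p, 0 ≤ T p) ∧ (∀ x, T (x, x) = 0) ∧ (∀ x y, T (x, y) = T (y, x)) ∧
  ∀ x y z, T (x, z) ≤ T (x, y) + T (y, z)

def shiftT {d : ℕ} (v : Rd d) (T : Rd d × Rd d → ℝ) : Rd d × Rd d → ℝ :=
  fun p => T (v + p.1, v + p.2)

variable {Ω : Type} [MeasurableSpace Ω]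

def ErgodicPM {d : ℕ} (P : Measure Ω) (T : Ω → Rd d × Rd d → ℝ) : Prop :=
  ∀ v : Rd d, v ≠ 0 →
    (Measure.map (fun ω => shiftT v (T ω)) P = Measure.map T P) ∧
    ∀ E : Set (Rd d × Rd d → ℝ), MeasurableSet E → shiftT v ⁻¹' E = E →
      P (T ⁻¹' E) = 0 ∨ P (T ⁻¹' E) = 1

def FiniteMoments {d : ℕ} (P : Measure Ω) (T : Ω → Rd d × Rd d → ℝ) : Prop :=
  ∀ x : Rd d, Integrable (fun ω => T ω (0, x)) P

def IsTimeConstant {d : ℕ} (P : Measure Ω) (T : Ω → Rd d × Rd d → ℝ) (μ : Rd d → ℝ) : Prop :=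
  (∀ x, 0 ≤ μ x) ∧
  (∀ (t : ℚ) (x : Rd d), μ ((t : ℝ) • x) = |(t : ℝ)| * μ x) ∧
  (∀ x y, μ (x + y) ≤ μ x + μ y) ∧
  ∀ v : Rd d,
    (∀ᵐ ω ∂P, Tendsto (fun n : ℕ => T ω (0, (n : ℝ) • v) / n) atTop (nhds (μ v))) ∧
    Tendsto (fun n : ℕ => ∫ ω, |T ω (0, (n : ℝ) • v) / n - μ v| ∂P) atTop (nhds 0)

def IsotropicPM {d : ℕ} (P : Measure Ω) (T : Ω → Rd d × Rd d → ℝ) : Prop :=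
  ∀ ρ : Rd d ≃ₗᵢ[ℝ] Rd d,
    Measure.map (fun ω => fun p : Rd d × Rd d => T ω (ρ p.1, ρ p.2)) P = Measure.map T P

/-! ### Birkhoff's theorem for ergodic maps -/

section Birkhoff

variable {X : Type*} {θ : X → X} {f : X → ℝ}

/-- The maximum of the first `n + 1` Birkhoff sums of `f`. -/
def birkhoffMax (θ : X → X) (f : X → ℝ) : ℕ → X → ℝ
  | 0, _ => 0
  | n + 1, x => max 0 (f x + birkhoffMax θ f n (θ x))

theorem birkhoffMax_nonneg (n : ℕ) (x : X) : 0 ≤ birkhoffMax θ f n x := by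
  cases n with
  | zero => exact le_rfl
  | succ n => exact le_max_left _ _

theorem birkhoffMax_le_succ (n : ℕ) (x : X) :
    birkhoffMax θ f n x ≤ birkhoffMax θ f (n + 1) x := by
  induction n generalizing x with
  | zero => exact birkhoffMax_nonneg 1 x
  | succ n ih => exact max_le_max le_rfl (add_le_add le_rfl (ih (θ x)))

theorem birkhoffSum_le_birkhoffMax (n : ℕ) (x : X) :
    birkhoffSum θ f n x ≤ birkhoffMax θ f n x := by
  induction n generalizing x with
  | zero => simp [birkhoffMax]
  | succ n ih =>
    rw [birkhoffSum_succ']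
    exact le_max_of_le_right (add_le_add le_rfl (ih (θ x)))

theorem bddAbove_birkhoffSum_iff (x : X) :
    BddAbove (range fun n => birkhoffSum θ f n (θ x)) ↔
      BddAbove (range fun n => birkhoffSum θ f n x) := by
  constructor
  · rintro ⟨C, hC⟩
    refine ⟨max 0 (f x + C), ?_⟩
    rintro _ ⟨n, rfl⟩
    cases n with
    | zero => simp
    | succ n =>
      simp only [birkhoffSum_succ']
      exact le_max_of_le_right (add_le_add le_rfl (hC ⟨n, rfl⟩))
  · rintro ⟨C, hC⟩
    refine ⟨C - f x, ?_⟩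
    rintro _ ⟨n, rfl⟩
    have := hC ⟨n + 1, rfl⟩
    simp only [birkhoffSum_succ'] at this
    simp only
    linarith

variable [MeasurableSpace X] {Q : Measure X}

theorem MeasureTheory.MeasurePreserving.integral_comp_of_measurable
    (hθ : MeasurePreserving θ Q Q) (hf : Measurable f) :
    ∫ x, f (θ x) ∂Q = ∫ x, f x ∂Q := by
  conv_rhs => rw [← hθ.map_eq]
  exact (integral_map hθ.measurable.aemeasurable hf.aestronglyMeasurable).symm

theorem measurable_birkhoffSum (hθ : Measurable θ) (hf : Measurable f) (n : ℕ) :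
    Measurable (birkhoffSum θ f n) := by
  unfold birkhoffSum
  exact Finset.measurable_sum _ fun i _ => hf.comp (hθ.iterate i)

theorem measurable_birkhoffMax (hθ : Measurable θ) (hf : Measurable f) (n : ℕ) :
    Measurable (birkhoffMax θ f n) := by
  induction n with
  | zero => exact measurable_const
  | succ n ih => exact measurable_const.max (hf.add (ih.comp hθ))

theorem integrable_birkhoffMax (hθ : MeasurePreserving θ Q Q) (hi : Integrable f Q) (n : ℕ) :
    Integrable (birkhoffMax θ f n) Q := by
  induction n with
  | zero => exact integrable_zero _ _ _
  | succ n ih =>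
    exact (integrable_zero _ _ _).sup (hi.add (hθ.integrable_comp_of_integrable ih))

/-- If `f` has negative mean, then its Birkhoff sums are almost surely bounded above. -/
theorem Ergodic.ae_bddAbove_birkhoffSum (hθ : Ergodic θ Q) (hf : Measurable f)
    (hi : Integrable f Q) (hneg : ∫ x, f x ∂Q < 0) :
    ∀ᵐ x ∂Q, BddAbove (range fun n => birkhoffSum θ f n x) := by
  have hS : MeasurableSet {x | BddAbove (range fun n => birkhoffSum θ f n x)} :=
    measurableSet_bddAbove_range (measurable_birkhoffSum hθ.measurable hf)
  rcases hθ.toPreErgodic.ae_mem_or_ae_notMem hS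
    (by ext x; exact bddAbove_birkhoffSum_iff x) with h | h
  · exact h
  exfalso
  have hM := measurable_birkhoffMax hθ.measurable hf
  have hMi := integrable_birkhoffMax hθ.toMeasurePreserving hi
  have hMθ : ∀ n, Integrable (fun x => birkhoffMax θ f n (θ x)) Q := fun n =>
    hθ.toMeasurePreserving.integrable_comp_of_integrable (hMi n)
  have key : ∀ n, 0 ≤ ∫ x, max (-birkhoffMax θ f n (θ x)) (f x) ∂Q := by
    intro n
    have e : ∀ x, max (-birkhoffMax θ f n (θ x)) (f x) =
        birkhoffMax θ f (n + 1) x - birkhoffMax θ f n (θ x) := by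
      intro x
      simp only [birkhoffMax]
      rw [← max_sub_sub_right]
      simp
    simp_rw [e]
    rw [integral_sub (hMi (n + 1)) (hMθ n),
      hθ.toMeasurePreserving.integral_comp_of_measurable (hM n), sub_nonneg]
    exact integral_mono (hMi n) (hMi (n + 1)) (birkhoffMax_le_succ n)
  have lim : Tendsto (fun n => ∫ x, max (-birkhoffMax θ f n (θ x)) (f x) ∂Q) atTop
      (nhds (∫ x, f x ∂Q)) := by
    refine tendsto_integral_of_dominated_convergence (fun x => |f x|) (fun n => ?_) hi.abs
      (fun n => ae_of_all _ fun x => ?_) ?_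
    · exact (((hM n).comp hθ.measurable).neg.max hf).aestronglyMeasurable
    · have := birkhoffMax_nonneg (θ := θ) (f := f) n (θ x)
      rw [Real.norm_eq_abs, abs_le]
      constructor
      · exact (neg_abs_le _).trans (le_max_right _ _)
      · exact max_le (by linarith [abs_nonneg (f x)]) (le_abs_self _)
    · filter_upwards [h] with x hx
      have hx' : ¬ BddAbove (range fun n => birkhoffSum θ f n (θ x)) := by
        rwa [bddAbove_birkhoffSum_iff]
      obtain ⟨_, ⟨N, rfl⟩, hN⟩ := not_bddAbove_iff.1 hx' (-f x)
      refine tendsto_const_nhds.congr' ?_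
      filter_upwards [eventually_ge_atTop N] with n hn
      have h1 := birkhoffSum_le_birkhoffMax (θ := θ) (f := f) N (θ x)
      have h2 : birkhoffMax θ f N (θ x) ≤ birkhoffMax θ f n (θ x) :=
        monotone_nat_of_le_succ (f := fun n => birkhoffMax θ f n (θ x))
          (fun n => birkhoffMax_le_succ n (θ x)) hn
      rw [max_eq_right]
      simp only at hN
      linarith
  exact absurd (ge_of_tendsto' lim key) (not_le.2 hneg)

theorem Ergodic.ae_eventually_birkhoffSum_div_lt [IsProbabilityMeasure Q] (hθ : Ergodic θ Q)
    (hf : Measurable f) (hi : Integrable f Q) {b : ℝ} (hb : ∫ x, f x ∂Q < b) :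
    ∀ᵐ x ∂Q, ∀ᶠ n : ℕ in atTop, birkhoffSum θ f n x / n < b := by
  obtain ⟨c, hc, hcb⟩ := exists_between hb
  have h := hθ.ae_bddAbove_birkhoffSum (f := fun x => f x - c) (hf.sub_const c)
    (hi.sub (integrable_const c)) (by
      rw [integral_sub hi (integrable_const c)]; simpa using hc)
  filter_upwards [h] with x ⟨C, hC⟩
  have hlim : Tendsto (fun n : ℕ => C / (n : ℝ)) atTop (nhds 0) :=
    tendsto_const_div_atTop_nhds_zero_nat C
  filter_upwards [hlim.eventually_lt_const (sub_pos.2 hcb), eventually_gt_atTop 0] with n hn hn0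
  have h1 := hC ⟨n, rfl⟩
  have hn0' : (0 : ℝ) < n := by exact_mod_cast hn0
  simp only [birkhoffSum, Finset.sum_sub_distrib, Finset.sum_const, Finset.card_range,
    nsmul_eq_mul] at h1 ⊢
  rw [div_lt_iff₀ hn0'] at hn ⊢
  linarith

/-- **Birkhoff's ergodic theorem** for an ergodic map of a probability space. -/
theorem Ergodic.ae_tendsto_birkhoffSum_div [IsProbabilityMeasure Q] (hθ : Ergodic θ Q)
    (hf : Measurable f) (hi : Integrable f Q) :
    ∀ᵐ x ∂Q, Tendsto (fun n : ℕ => birkhoffSum θ f n x / n) atTop (nhds (∫ x, f x ∂Q)) := by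
  have h1 : ∀ᵐ x ∂Q, ∀ k : ℕ, ∀ᶠ n : ℕ in atTop,
      birkhoffSum θ f n x / n < ∫ x, f x ∂Q + 1 / ((k : ℝ) + 1) :=
    ae_all_iff.2 fun k => hθ.ae_eventually_birkhoffSum_div_lt hf hi
      (lt_add_of_pos_right _ Nat.one_div_pos_of_nat)
  have h2 : ∀ᵐ x ∂Q, ∀ k : ℕ, ∀ᶠ n : ℕ in atTop,
      birkhoffSum θ (-f) n x / n < -∫ x, f x ∂Q + 1 / ((k : ℝ) + 1) :=
    ae_all_iff.2 fun k => hθ.ae_eventually_birkhoffSum_div_lt hf.neg hi.neg (by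
      simp only [Pi.neg_apply, integral_neg]
      exact lt_add_of_pos_right _ Nat.one_div_pos_of_nat)
  filter_upwards [h1, h2] with x hx1 hx2
  refine tendsto_order.2 ⟨fun a ha => ?_, fun b hb => ?_⟩
  · obtain ⟨k, hk⟩ := exists_nat_one_div_lt (sub_pos.2 ha)
    filter_upwards [hx2 k] with n hn
    rw [birkhoffSum_neg, neg_div] at hn
    linarith
  · obtain ⟨k, hk⟩ := exists_nat_one_div_lt (sub_pos.2 hb)
    filter_upwards [hx1 k] with n hn
    linarith

theorem Ergodic.ae_tendsto_iterate_div [IsProbabilityMeasure Q] (hθ : Ergodic θ Q)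
    (hf : Measurable f) (hi : Integrable f Q) :
    ∀ᵐ x ∂Q, Tendsto (fun n : ℕ => f (θ^[n] x) / n) atTop (nhds 0) := by
  filter_upwards [hθ.ae_tendsto_birkhoffSum_div hf hi] with x hx
  have h1 := hx.comp (tendsto_add_atTop_nat 1)
  have h2 : Tendsto (fun n : ℕ => 1 + 1 / (n : ℝ)) atTop (nhds (1 + 0)) :=
    tendsto_const_nhds.add tendsto_one_div_atTop_nhds_zero_nat
  have h3 := (h1.mul h2).sub hx
  rw [add_zero, mul_one, sub_self] at h3
  refine h3.congr' ?_
  filter_upwards [eventually_gt_atTop 0] with n hn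
  have hn0 : (n : ℝ) ≠ 0 := by positivity
  simp only [Function.comp_apply, birkhoffSum_succ, Nat.cast_add, Nat.cast_one]
  field_simp
  ring

end Birkhoff

/-! ### The subadditive ergodic theorem for stationary pseudometrics on `ℕ` -/

section Sequence

/-- Pseudometrics on `ℕ`. -/
def IsNatPseudometric (D : ℕ → ℕ → ℝ) : Prop :=
  (∀ i j, 0 ≤ D i j) ∧ (∀ i, D i i = 0) ∧ (∀ i j, D i j = D j i) ∧
    ∀ i j k, D i k ≤ D i j + D j k

namespace IsNatPseudometric

variable {D : ℕ → ℕ → ℝ}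

theorem mul_le_sum (h : IsNatPseudometric D) (m n : ℕ) :
    m * D 0 n ≤ ∑ i ∈ Finset.range n, D i (i + m) + ∑ j ∈ Finset.range m, D 0 j +
      ∑ j ∈ Finset.range m, D n (n + j) := by
  obtain ⟨-, -, hsymm, htri⟩ := h
  have h1 : ∀ n, ∑ j ∈ Finset.range m, D 0 (n + j) ≤
      ∑ i ∈ Finset.range n, D i (i + m) + ∑ j ∈ Finset.range m, D 0 j := by
    intro n
    induction n with
    | zero => simp
    | succ n ih =>
      have e := Finset.sum_range_succ' (fun j => D 0 (n + j)) m
      rw [Finset.sum_range_succ] at e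
      have e' : ∑ j ∈ Finset.range m, D 0 (n + 1 + j) =
          ∑ j ∈ Finset.range m, D 0 (n + (j + 1)) :=
        Finset.sum_congr rfl fun j _ => by rw [add_assoc, add_comm 1 j]
      rw [Finset.sum_range_succ, e']
      have := htri 0 n (n + m)
      simp only [add_zero] at e
      linarith
  have h2 : m * D 0 n ≤ ∑ j ∈ Finset.range m, (D 0 (n + j) + D n (n + j)) := by
    have : ∑ _j ∈ Finset.range m, D 0 n ≤ ∑ j ∈ Finset.range m, (D 0 (n + j) + D n (n + j)) :=
      Finset.sum_le_sum fun j _ => by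
        have := htri 0 (n + j) n
        rwa [hsymm (n + j) n] at this
    simpa using this
  rw [Finset.sum_add_distrib] at h2
  linarith [h1 n]

theorem le_sum_Ico (h : IsNatPseudometric D) {s n : ℕ} (hsn : s ≤ n) :
    D s n ≤ ∑ i ∈ Finset.Ico s n, D i (i + 1) := by
  induction n, hsn using Nat.le_induction with
  | base => simp [h.2.1]
  | succ n hsn ih =>
    rw [Finset.sum_Ico_succ_top hsn]
    linarith [h.2.2.2 s n (n + 1)]

/-- If from each `i` one can either jump at most `M` steps ahead at speed `b`, or else pay `w i`
for a single step, then `D 0 n` is bounded accordingly, up to a boundary term. -/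
theorem le_of_jumps (h : IsNatPseudometric D) {b : ℝ} (hb : 0 ≤ b) {M : ℕ} {w : ℕ → ℝ}
    (hw : ∀ i, 0 ≤ w i)
    (hjump : ∀ i, D i (i + 1) ≤ w i ∨ ∃ k, 0 < k ∧ k ≤ M ∧ D i (i + k) ≤ b * k) (n : ℕ) :
    D 0 n ≤ b * n + ∑ i ∈ Finset.range n, w i + ∑ i ∈ Finset.Ico (n - M) n, D i (i + 1) := by
  have key : ∀ r s, s + r = n → D s n ≤ b * r + ∑ i ∈ Finset.Ico s n, w i +
      ∑ i ∈ Finset.Ico (n - M) n, D i (i + 1) := by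
    intro r
    induction r using Nat.strong_induction_on with
    | _ r ih =>
      intro s hs
      have hW : 0 ≤ ∑ i ∈ Finset.Ico s n, w i := Finset.sum_nonneg fun i _ => hw i
      have hC : 0 ≤ ∑ i ∈ Finset.Ico (n - M) n, D i (i + 1) :=
        Finset.sum_nonneg fun i _ => h.1 _ _
      have hbr : 0 ≤ b * r := by positivity
      by_cases hrM : r ≤ M
      · have h1 := h.le_sum_Ico (show s ≤ n by omega)
        have h2 : ∑ i ∈ Finset.Ico s n, D i (i + 1) ≤
            ∑ i ∈ Finset.Ico (n - M) n, D i (i + 1) :=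
          Finset.sum_le_sum_of_subset_of_nonneg
            (Finset.Ico_subset_Ico_left (by omega)) fun i _ _ => h.1 _ _
        linarith
      · rcases hjump s with h1 | ⟨k, hk0, hkM, hk⟩
        · rcases Nat.eq_zero_or_pos r with h0 | h0
          · omega
          have h2 := ih (r - 1) (by omega) (s + 1) (by omega)
          have h3 := h.2.2.2 s (s + 1) n
          have h4 := Finset.sum_eq_sum_Ico_succ_bot (show s < n by omega) w
          have h5 : ((r - 1 : ℕ) : ℝ) ≤ r := by exact_mod_cast Nat.sub_le r 1
          have h6 := mul_le_mul_of_nonneg_left h5 hb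
          linarith
        · have h2 := ih (r - k) (by omega) (s + k) (by omega)
          have h3 := h.2.2.2 s (s + k) n
          have h4 : ∑ i ∈ Finset.Ico (s + k) n, w i ≤ ∑ i ∈ Finset.Ico s n, w i :=
            Finset.sum_le_sum_of_subset_of_nonneg
              (Finset.Ico_subset_Ico_left (by omega)) fun i _ _ => hw i
          have h5 : ((r - k : ℕ) : ℝ) = r - k := by
            rw [Nat.cast_sub (by omega)]
          rw [h5] at h2
          linarith
  simpa using key n 0 (by simp)

end IsNatPseudometric

variable {X : Type*} {θ : X → X} {D : X → ℕ → ℕ → ℝ}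

theorem apply_iterate_of_shift (hD : ∀ x i j, D (θ x) i j = D x (i + 1) (j + 1)) (n : ℕ) (x : X)
    (i j : ℕ) : D (θ^[n] x) i j = D x (n + i) (n + j) := by
  induction n generalizing x with
  | zero => simp
  | succ n ih =>
    rw [Function.iterate_succ_apply, ih, hD, show n + i + 1 = n + 1 + i by omega,
      show n + j + 1 = n + 1 + j by omega]

variable [MeasurableSpace X] {Q : Measure X}

/-- A stationary ergodic random pseudometric on `ℕ` with finite moments. -/
structure IsErgodicSequence (Q : Measure X) (θ : X → X) (D : X → ℕ → ℕ → ℝ) : Prop where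
  ergodic : Ergodic θ Q
  measurable : ∀ i j, Measurable fun x => D x i j
  shift : ∀ x i j, D (θ x) i j = D x (i + 1) (j + 1)
  pseudometric : ∀ᵐ x ∂Q, IsNatPseudometric (D x)
  integrable_zero : ∀ n, Integrable (fun x => D x 0 n) Q

namespace IsErgodicSequence

variable (h : IsErgodicSequence Q θ D)

include h

theorem iterate (n k : ℕ) (x : X) : D (θ^[n] x) 0 k = D x n (n + k) := by
  simpa using apply_iterate_of_shift h.shift n x 0 k

theorem integrable_add (n k : ℕ) : Integrable (fun x => D x n (n + k)) Q := by
  simpa only [← h.iterate, Function.comp_def] using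
    (h.ergodic.toMeasurePreserving.iterate n).integrable_comp_of_integrable (h.integrable_zero k)

theorem integral_add (n k : ℕ) : ∫ x, D x n (n + k) ∂Q = ∫ x, D x 0 k ∂Q := by
  simpa only [← h.iterate] using
    (h.ergodic.toMeasurePreserving.iterate n).integral_comp_of_measurable (h.measurable 0 k)

theorem subadditive : Subadditive fun n => ∫ x, D x 0 n ∂Q := by
  intro m n
  simp only
  rw [← h.integral_add m n, ← MeasureTheory.integral_add (h.integrable_zero m)
    (h.integrable_add m n)]
  refine integral_mono_ae (h.integrable_zero _)
    ((h.integrable_zero m).add (h.integrable_add m n)) ?_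
  filter_upwards [h.pseudometric] with x hx using hx.2.2.2 0 m (m + n)

theorem integral_nonneg (n : ℕ) : 0 ≤ ∫ x, D x 0 n ∂Q :=
  integral_nonneg_of_ae <| h.pseudometric.mono fun _ hx => hx.1 0 n

theorem bddBelow : BddBelow (range fun n : ℕ => (∫ x, D x 0 n ∂Q) / n) := by
  refine ⟨0, ?_⟩
  rintro _ ⟨n, rfl⟩
  exact div_nonneg (h.integral_nonneg n) n.cast_nonneg

theorem lim_mul_le (n : ℕ) : h.subadditive.lim * n ≤ ∫ x, D x 0 n ∂Q := by
  rcases Nat.eq_zero_or_pos n with rfl | hn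
  · simpa using h.integral_nonneg 0
  · rw [← le_div_iff₀ (by positivity)]
    exact h.subadditive.lim_le_div h.bddBelow hn.ne'

variable [IsProbabilityMeasure Q]

theorem ae_eventually_lt {b : ℝ} (hb : h.subadditive.lim < b) :
    ∀ᵐ x ∂Q, ∀ᶠ n : ℕ in atTop, D x 0 n / n < b := by
  obtain ⟨m, hmb, hm⟩ := (((h.subadditive.tendsto_lim h.bddBelow).eventually_lt_const hb).and
    (eventually_gt_atTop 0)).exists
  have hm0 : (0 : ℝ) < m := by exact_mod_cast hm
  rw [div_lt_iff₀ hm0] at hmb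
  have h1 := h.ergodic.ae_tendsto_birkhoffSum_div (h.measurable 0 m) (h.integrable_zero m)
  have h2 : ∀ᵐ x ∂Q, ∀ j : ℕ, Tendsto (fun n : ℕ => D (θ^[n] x) 0 j / n) atTop (nhds 0) :=
    ae_all_iff.2 fun j => h.ergodic.ae_tendsto_iterate_div (h.measurable 0 j) (h.integrable_zero j)
  filter_upwards [h1, h2, h.pseudometric] with x hx1 hx2 hx
  have hsum : Tendsto (fun n : ℕ => ∑ j ∈ Finset.range m, D (θ^[n] x) 0 j / n) atTop
      (nhds (∑ _j ∈ Finset.range m, 0)) := tendsto_finsetSum _ fun j _ => hx2 j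
  have hlim := (hx1.add (tendsto_const_div_atTop_nhds_zero_nat
    (∑ j ∈ Finset.range m, D x 0 j))).add hsum
  simp only [Finset.sum_const_zero, add_zero] at hlim
  filter_upwards [hlim.eventually_lt_const hmb, eventually_gt_atTop 0] with n hn hn0
  have hn0' : (0 : ℝ) < n := by exact_mod_cast hn0
  have key := hx.mul_le_sum m n
  simp only [birkhoffSum, h.iterate, ← Finset.sum_div, ← add_div] at hn
  rw [div_lt_iff₀ hn0'] at hn ⊢
  have : (m : ℝ) * D x 0 n < m * (b * n) := by linarith
  exact lt_of_mul_lt_mul_left this hm0.le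

/-- If `D x 0 n < b * n` has a solution `n > 0` almost surely, then the mean speed is at
most `b`. -/
theorem lim_le_of_ae_exists {b : ℝ} (hb0 : 0 ≤ b)
    (hb : ∀ᵐ x ∂Q, ∃ k : ℕ, 0 < k ∧ D x 0 k < b * k) : h.subadditive.lim ≤ b := by
  let A : ℕ → Set X := fun M => {x | ∃ k, 0 < k ∧ k ≤ M ∧ D x 0 k ≤ b * k}
  have hA : ∀ M, MeasurableSet (A M) := fun M => by
    simp only [A, ofPred_exists, ofPred_and]
    exact MeasurableSet.iUnion fun k => (MeasurableSet.const _).inter <|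
      (MeasurableSet.const _).inter (measurableSet_le (h.measurable 0 k) measurable_const)
  let w : ℕ → X → ℝ := fun M => (A M)ᶜ.indicator fun x => D x 0 1
  have hwm : ∀ M, Measurable (w M) := fun M => (h.measurable 0 1).indicator (hA M).compl
  have hwi : ∀ M, Integrable (w M) Q := fun M => (h.integrable_zero 1).indicator (hA M).compl
  have key : ∀ M, h.subadditive.lim ≤ b + ∫ x, w M x ∂Q := by
    intro M
    have hwi' : ∀ i, Integrable (fun x => w M (θ^[i] x)) Q := fun i =>
      (h.ergodic.toMeasurePreserving.iterate i).integrable_comp_of_integrable (hwi M)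
    have hwI : ∀ i, ∫ x, w M (θ^[i] x) ∂Q = ∫ x, w M x ∂Q := fun i =>
      (h.ergodic.toMeasurePreserving.iterate i).integral_comp_of_measurable (hwm M)
    have hbound : ∀ n : ℕ, ∫ x, D x 0 n ∂Q ≤
        b * n + n * ∫ x, w M x ∂Q + M * ∫ x, D x 0 1 ∂Q := by
      intro n
      have hI1 : Integrable (fun x => ∑ i ∈ Finset.range n, w M (θ^[i] x)) Q :=
        integrable_finsetSum _ fun i _ => hwi' i
      have hI2 : Integrable (fun x => ∑ i ∈ Finset.Ico (n - M) n, D x i (i + 1)) Q :=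
        integrable_finsetSum _ fun i _ => h.integrable_add i 1
      have h1 : ∫ x, D x 0 n ∂Q ≤ ∫ x, (b * n + ∑ i ∈ Finset.range n, w M (θ^[i] x) +
          ∑ i ∈ Finset.Ico (n - M) n, D x i (i + 1)) ∂Q := by
        refine integral_mono_ae (h.integrable_zero n)
          (((integrable_const _).add hI1).add hI2) ?_
        filter_upwards [h.pseudometric] with x hx
        refine hx.le_of_jumps hb0 (fun i => ?_) (fun i => ?_) n
        · refine indicator_apply_nonneg fun _ => ?_
          rw [h.iterate]
          exact hx.1 _ _
        · by_cases hi : θ^[i] x ∈ A M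
          · obtain ⟨k, h0, h1, h2⟩ := hi
            rw [h.iterate] at h2
            exact Or.inr ⟨k, h0, h1, h2⟩
          · left
            have : w M (θ^[i] x) = D (θ^[i] x) 0 1 := indicator_of_mem hi _
            rw [this, h.iterate]
      have h2 : ∫ x, (b * n + ∑ i ∈ Finset.range n, w M (θ^[i] x) +
          ∑ i ∈ Finset.Ico (n - M) n, D x i (i + 1)) ∂Q =
          b * n + n * ∫ x, w M x ∂Q + (n - (n - M) : ℕ) * ∫ x, D x 0 1 ∂Q := by
        have hI3 : Integrable (fun x => b * n + ∑ i ∈ Finset.range n, w M (θ^[i] x)) Q :=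
          (integrable_const _).add hI1
        rw [MeasureTheory.integral_add hI3 hI2,
          MeasureTheory.integral_add (integrable_const _) hI1,
          integral_finsetSum _ fun i _ => hwi' i,
          integral_finsetSum _ fun i _ => h.integrable_add i 1]
        simp only [hwI, h.integral_add]
        simp
      have h3 : ((n - (n - M) : ℕ) : ℝ) ≤ M := by exact_mod_cast (by omega : n - (n - M) ≤ M)
      have h4 := mul_le_mul_of_nonneg_right h3 (h.integral_nonneg 1)
      linarith
    have hlim : Tendsto (fun n : ℕ => b + ∫ x, w M x ∂Q + (M * ∫ x, D x 0 1 ∂Q) / n) atTop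
        (nhds (b + ∫ x, w M x ∂Q + 0)) :=
      tendsto_const_nhds.add (tendsto_const_div_atTop_nhds_zero_nat _)
    rw [add_zero] at hlim
    refine ge_of_tendsto hlim ?_
    filter_upwards [eventually_gt_atTop 0] with n hn
    have hn0 : (0 : ℝ) < n := by exact_mod_cast hn
    have h1 := (h.lim_mul_le n).trans (hbound n)
    rw [← mul_le_mul_iff_of_pos_right hn0]
    refine h1.trans (le_of_eq ?_)
    field_simp
  have hw : Tendsto (fun M => ∫ x, w M x ∂Q) atTop (nhds (∫ _, (0 : ℝ) ∂Q)) := by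
    refine tendsto_integral_of_dominated_convergence (fun x => |D x 0 1|)
      (fun M => (hwm M).aestronglyMeasurable) (h.integrable_zero 1).abs
      (fun M => ae_of_all _ fun x => norm_indicator_le_norm_self _ _) ?_
    filter_upwards [hb] with x ⟨k, hk0, hk⟩
    refine tendsto_const_nhds.congr' ?_
    filter_upwards [eventually_ge_atTop k] with M hM
    exact (indicator_of_notMem (not_not.2 ⟨k, hk0, hM, hk.le⟩) _).symm
  have := ge_of_tendsto' (hw.const_add b) key
  simpa using this

/-- The event that `liminf D x 0 n / n ≤ a` has probability zero or one. -/
theorem ae_slow_or_ae_not_slow (a : ℝ) :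
    (∀ᵐ x ∂Q, ∀ k : ℕ, ∃ᶠ n : ℕ in atTop, D x 0 n < (a + 1 / ((k : ℝ) + 1)) * n) ∨
      ∀ᵐ x ∂Q, ¬ ∀ k : ℕ, ∃ᶠ n : ℕ in atTop, D x 0 n < (a + 1 / ((k : ℝ) + 1)) * n := by
  let B : Set X := {x | ∀ k : ℕ, ∃ᶠ n : ℕ in atTop, D x 0 n < (a + 1 / ((k : ℝ) + 1)) * n}
  have hB : MeasurableSet B := by
    simp only [B, frequently_atTop, ofPred_forall, ofPred_exists, ofPred_and]
    exact MeasurableSet.iInter fun k => MeasurableSet.iInter fun N => MeasurableSet.iUnion fun n =>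
      (MeasurableSet.const _).inter (measurableSet_lt (h.measurable 0 n) measurable_const)
  have hinv : θ ⁻¹' B ≤ᵐ[Q] B := by
    filter_upwards [h.pseudometric] with x hx hxB k
    have hlim : Tendsto (fun n : ℕ => (1 / ((k : ℝ) + 1) - 1 / ((k : ℝ) + 1 + 1)) * n)
        atTop atTop := by
      refine tendsto_natCast_atTop_atTop.const_mul_atTop (sub_pos.2 ?_)
      exact one_div_lt_one_div_of_lt (by positivity) (by linarith)
    have hfreq := (hxB (k + 1)).and_eventually
      (hlim.eventually_ge_atTop (D x 0 1 - (a + 1 / ((k : ℝ) + 1))))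
    refine (tendsto_add_atTop_nat 1).frequently (hfreq.mono fun n hn => ?_)
    obtain ⟨h1, h2⟩ := hn
    rw [h.shift] at h1
    have h3 := hx.2.2.2 0 1 (n + 1)
    push_cast at h1 ⊢
    linarith
  rcases h.ergodic.ae_empty_or_univ_of_preimage_ae_le hB.nullMeasurableSet hinv with h0 | h0
  · exact Or.inr (eventuallyEq_empty.1 h0)
  · exact Or.inl (eventuallyEq_univ.1 h0)

theorem ae_eventually_ge {a : ℝ} (ha : a < h.subadditive.lim) :
    ∀ᵐ x ∂Q, ∀ᶠ n : ℕ in atTop, a ≤ D x 0 n / n := by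
  rcases h.ae_slow_or_ae_not_slow a with hs | hs
  · exfalso
    obtain ⟨k, hk⟩ := exists_nat_one_div_lt (sub_pos.2 ha)
    have hex : ∀ᵐ x ∂Q, ∃ n : ℕ, 0 < n ∧ D x 0 n < (a + 1 / ((k : ℝ) + 1)) * n := by
      filter_upwards [hs] with x hx
      obtain ⟨n, hn, hn0⟩ := ((hx k).and_eventually (eventually_gt_atTop 0)).exists
      exact ⟨n, hn0, hn⟩
    have hb0 : 0 ≤ a + 1 / ((k : ℝ) + 1) := by
      obtain ⟨x, ⟨n, hn0, hn⟩, hx⟩ := (hex.and h.pseudometric).exists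
      have := (hx.1 0 n).trans_lt hn
      exact (pos_of_mul_pos_left this n.cast_nonneg).le
    linarith [h.lim_le_of_ae_exists hb0 hex]
  · filter_upwards [hs] with x hx
    push Not at hx
    obtain ⟨k, hk⟩ := hx
    filter_upwards [hk, eventually_gt_atTop 0] with n hn hn0
    have hn0' : (0 : ℝ) < n := by exact_mod_cast hn0
    rw [le_div_iff₀ hn0']
    refine le_trans (mul_le_mul_of_nonneg_right ?_ hn0'.le) hn
    linarith [Nat.one_div_pos_of_nat (α := ℝ) (n := k)]

/-- **Kingman's subadditive ergodic theorem** for ergodic pseudometrics on `ℕ`. -/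
theorem ae_tendsto :
    ∀ᵐ x ∂Q, Tendsto (fun n : ℕ => D x 0 n / n) atTop (nhds h.subadditive.lim) := by
  have h1 : ∀ᵐ x ∂Q, ∀ k : ℕ, ∀ᶠ n : ℕ in atTop,
      D x 0 n / n < h.subadditive.lim + 1 / ((k : ℝ) + 1) :=
    ae_all_iff.2 fun k => h.ae_eventually_lt (lt_add_of_pos_right _ Nat.one_div_pos_of_nat)
  have h2 : ∀ᵐ x ∂Q, ∀ k : ℕ, ∀ᶠ n : ℕ in atTop,
      h.subadditive.lim - 1 / ((k : ℝ) + 1) ≤ D x 0 n / n :=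
    ae_all_iff.2 fun k => h.ae_eventually_ge (sub_lt_self _ Nat.one_div_pos_of_nat)
  filter_upwards [h1, h2] with x hx1 hx2
  refine tendsto_order.2 ⟨fun a ha => ?_, fun b hb => ?_⟩
  · obtain ⟨k, hk⟩ := exists_nat_one_div_lt (sub_pos.2 ha)
    filter_upwards [hx2 k] with n hn
    linarith
  · obtain ⟨k, hk⟩ := exists_nat_one_div_lt (sub_pos.2 hb)
    filter_upwards [hx1 k] with n hn
    linarith

end IsErgodicSequence

end Sequence

/-- **Scheffé's lemma** for a constant limit. -/
theorem tendsto_integral_abs_sub_of_nonneg {X : Type*} [MeasurableSpace X] {Q : Measure X}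
    [IsProbabilityMeasure Q] {f : ℕ → X → ℝ} {c : ℝ} (hf : ∀ n, Integrable (f n) Q)
    (hpos : ∀ n x, 0 ≤ f n x) (hae : ∀ᵐ x ∂Q, Tendsto (fun n => f n x) atTop (nhds c))
    (hmean : Tendsto (fun n => ∫ x, f n x ∂Q) atTop (nhds c)) :
    Tendsto (fun n => ∫ x, |f n x - c| ∂Q) atTop (nhds 0) := by
  have hI : ∀ n, Integrable (fun x => max (c - f n x) 0) Q := fun n =>
    ((integrable_const c).sub (hf n)).sup (integrable_zero _ _ _)
  have h1 : Tendsto (fun n => ∫ x, max (c - f n x) 0 ∂Q) atTop (nhds (∫ _, (0 : ℝ) ∂Q)) := by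
    refine tendsto_integral_of_dominated_convergence (fun _ => |c|)
      (fun n => (hI n).aestronglyMeasurable) (integrable_const _)
      (fun n => ae_of_all _ fun x => ?_) ?_
    · rw [Real.norm_eq_abs, abs_of_nonneg (le_max_right _ _)]
      exact max_le (by linarith [le_abs_self c, hpos n x]) (abs_nonneg c)
    · filter_upwards [hae] with x hx
      simpa using (hx.const_sub c).max (tendsto_const_nhds (x := (0 : ℝ)))
  have h2 : ∀ n, ∫ x, |f n x - c| ∂Q =
      ∫ x, f n x ∂Q - c + 2 * ∫ x, max (c - f n x) 0 ∂Q := by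
    intro n
    have e : ∀ x, |f n x - c| = f n x - c + 2 * max (c - f n x) 0 := by
      intro x
      rcases le_total (f n x) c with hx | hx
      · rw [abs_of_nonpos (by linarith), max_eq_left (by linarith)]
        ring
      · rw [abs_of_nonneg (by linarith), max_eq_right (by linarith)]
        ring
    have hfc : Integrable (fun x => f n x - c) Q := (hf n).sub (integrable_const c)
    simp_rw [e]
    rw [integral_add hfc ((hI n).const_mul 2),
      integral_sub (hf n) (integrable_const c), integral_const_mul]
    simp
  simp_rw [h2]
  simpa using (hmean.sub_const c).add (h1.const_mul 2)

/-! ### Random pseudometrics on `ℝ^d` -/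

section RandomPseudometric

variable {d : ℕ} {P : Measure Ω} {T : Ω → Rd d × Rd d → ℝ}

theorem measurable_shiftT (v : Rd d) : Measurable (shiftT v) :=
  measurable_pi_lambda _ fun _ => measurable_pi_apply _

theorem integral_apply_eq_of_map_eq {S : Ω → Rd d × Rd d → ℝ} (hS : Measurable S)
    (hT : Measurable T) (h : Measure.map S P = Measure.map T P) (p : Rd d × Rd d) :
    ∫ ω, S ω p ∂P = ∫ ω, T ω p ∂P := by
  have hp : ∀ Q : Measure (Rd d × Rd d → ℝ), AEStronglyMeasurable (fun T => T p) Q := fun Q =>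
    (measurable_pi_apply p).aestronglyMeasurable
  rw [← integral_map hS.aemeasurable (hp _), h, integral_map hT.aemeasurable (hp _)]

theorem integrable_apply_of_map_eq {S : Ω → Rd d × Rd d → ℝ} (hS : Measurable S)
    (hT : Measurable T) (h : Measure.map S P = Measure.map T P) {p : Rd d × Rd d}
    (hi : Integrable (fun ω => T ω p) P) : Integrable (fun ω => S ω p) P := by
  have hp : ∀ Q : Measure (Rd d × Rd d → ℝ), AEStronglyMeasurable (fun T => T p) Q := fun Q =>
    (measurable_pi_apply p).aestronglyMeasurable
  have h1 := (integrable_map_measure (hp _) hT.aemeasurable).2 hi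
  rw [← h] at h1
  exact (integrable_map_measure (hp _) hS.aemeasurable).1 h1

namespace ErgodicPM

variable (hT : Measurable T) (herg : ErgodicPM P T)

include hT herg

theorem integral_add (v x : Rd d) : ∫ ω, T ω (v, v + x) ∂P = ∫ ω, T ω (0, x) ∂P := by
  by_cases hv : v = 0
  · simp [hv]
  simpa [shiftT] using integral_apply_eq_of_map_eq ((measurable_shiftT v).comp hT) hT
    (herg v hv).1 (0, x)

theorem integrable_add (hmom : FiniteMoments P T) (v x : Rd d) :
    Integrable (fun ω => T ω (v, v + x)) P := by
  by_cases hv : v = 0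
  · simpa [hv] using hmom x
  simpa [shiftT] using integrable_apply_of_map_eq ((measurable_shiftT v).comp hT) hT
    (herg v hv).1 (hmom x)

theorem integral_neg (hpseudo : ∀ ω, IsPseudometric (T ω)) (x : Rd d) :
    ∫ ω, T ω (0, -x) ∂P = ∫ ω, T ω (0, x) ∂P := by
  rw [← herg.integral_add hT x (-x)]
  simp only [add_neg_cancel]
  exact integral_congr_ae <| ae_of_all _ fun ω => (hpseudo ω).2.2.1 x 0

theorem integral_add_le (hpseudo : ∀ ω, IsPseudometric (T ω)) (hmom : FiniteMoments P T)
    (x y : Rd d) :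
    ∫ ω, T ω (0, x + y) ∂P ≤ ∫ ω, T ω (0, x) ∂P + ∫ ω, T ω (0, y) ∂P := by
  rw [← herg.integral_add hT x y,
    ← MeasureTheory.integral_add (hmom x) (herg.integrable_add hT hmom x y)]
  exact integral_mono (hmom _) ((hmom x).add (herg.integrable_add hT hmom x y))
    fun ω => (hpseudo ω).2.2.2 0 x (x + y)

theorem ergodic_shiftT [IsProbabilityMeasure P] {v : Rd d} (hv : v ≠ 0) :
    Ergodic (shiftT v) (Measure.map T P) where
  measurable := measurable_shiftT v
  map_eq := by
    rw [Measure.map_map (measurable_shiftT v) hT]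
    exact (herg v hv).1
  aeconst_set := by
    have := Measure.isProbabilityMeasure_map hT.aemeasurable (μ := P)
    intro E hE hinv
    rw [eventuallyConst_set']
    rcases (herg v hv).2 E hE hinv with h | h
    · left
      rw [ae_eq_empty, Measure.map_apply hT hE, h]
    · right
      rw [ae_eq_univ, prob_compl_eq_zero_iff hE, Measure.map_apply hT hE, h]

/-- The restriction of an ergodic random pseudometric to the multiples of a vector. -/
theorem isErgodicSequence [IsProbabilityMeasure P] (hpseudo : ∀ ω, IsPseudometric (T ω))
    (hmom : FiniteMoments P T) {v : Rd d} (hv : v ≠ 0) :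
    IsErgodicSequence (Measure.map T P) (shiftT v)
      (fun S (i j : ℕ) => S ((i : ℝ) • v, (j : ℝ) • v)) where
  ergodic := herg.ergodic_shiftT hT hv
  measurable _ _ := measurable_pi_apply _
  shift S i j := by
    simp only [shiftT, Nat.cast_add, Nat.cast_one, add_smul, one_smul, add_comm v]
  pseudometric := by
    rw [ae_map_iff hT.aemeasurable]
    · exact ae_of_all _ fun ω => ⟨fun _ _ => (hpseudo ω).1 _, fun _ => (hpseudo ω).2.1 _,
        fun _ _ => (hpseudo ω).2.2.1 _ _, fun _ _ _ => (hpseudo ω).2.2.2 _ _ _⟩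
    · have hm : ∀ p : Rd d × Rd d, Measurable fun S : Rd d × Rd d → ℝ => S p :=
        measurable_pi_apply
      simp only [IsNatPseudometric, ofPred_forall, ofPred_and]
      refine .inter (.iInter fun i => .iInter fun j => measurableSet_le measurable_const (hm _)) <|
        .inter (.iInter fun i => measurableSet_eq_fun (hm _) measurable_const) <|
        .inter (.iInter fun i => .iInter fun j => measurableSet_eq_fun (hm _) (hm _)) <|
        .iInter fun i => .iInter fun j => .iInter fun k =>
          measurableSet_le (hm _) ((hm _).add (hm _))
  integrable_zero n := by
    rw [integrable_map_measure (measurable_pi_apply _).aestronglyMeasurable hT.aemeasurable]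
    simpa [Function.comp_def] using hmom ((n : ℝ) • v)

theorem exists_tendsto [IsProbabilityMeasure P] (hpseudo : ∀ ω, IsPseudometric (T ω))
    (hmom : FiniteMoments P T) (v : Rd d) : ∃ c : ℝ,
    Tendsto (fun n : ℕ => (∫ ω, T ω (0, (n : ℝ) • v) ∂P) / n) atTop (nhds c) ∧
    ∀ᵐ ω ∂P, Tendsto (fun n : ℕ => T ω (0, (n : ℝ) • v) / n) atTop (nhds c) := by
  by_cases hv : v = 0
  · exact ⟨0, by simp [hv, (hpseudo _).2.1]⟩
  have := Measure.isProbabilityMeasure_map hT.aemeasurable (μ := P)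
  have h := herg.isErgodicSequence hT hpseudo hmom hv
  refine ⟨h.subadditive.lim, ?_, ?_⟩
  · refine (h.subadditive.tendsto_lim h.bddBelow).congr fun n => ?_
    rw [integral_map hT.aemeasurable (measurable_pi_apply _).aestronglyMeasurable]
    simp
  · simpa using ae_of_ae_map hT.aemeasurable h.ae_tendsto

end ErgodicPM

end RandomPseudometric

/-- The asymptotic slope of an even subadditive function along rays is homogeneous over the
rationals. -/
theorem slope_rat_smul {E : Type*} [AddCommGroup E] [Module ℝ E] {e μ : E → ℝ}
    (heven : ∀ x, e (-x) = e x)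
    (hlim : ∀ x, Tendsto (fun n : ℕ => e ((n : ℝ) • x) / n) atTop (nhds (μ x)))
    (t : ℚ) (x : E) : μ ((t : ℝ) • x) = |(t : ℝ)| * μ x := by
  have hneg : ∀ x, μ (-x) = μ x := fun x =>
    tendsto_nhds_unique ((hlim (-x)).congr fun n => by rw [smul_neg, heven]) (hlim x)
  have h0 : μ 0 = 0 :=
    tendsto_nhds_unique (hlim 0) (by simpa using tendsto_const_div_atTop_nhds_zero_nat (e 0))
  have hnat : ∀ (k : ℕ) (x : E), μ ((k : ℝ) • x) = k * μ x := by
    intro k x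
    rcases Nat.eq_zero_or_pos k with rfl | hk
    · simp [h0]
    have hsub : Tendsto (fun n : ℕ => n * k) atTop atTop :=
      tendsto_id.atTop_mul_const' hk
    refine tendsto_nhds_unique (hlim _) ((((hlim x).comp hsub).const_mul (k : ℝ)).congr fun n => ?_)
    have hk0 : (k : ℝ) ≠ 0 := by positivity
    simp only [Function.comp_apply, Nat.cast_mul, mul_smul]
    rw [mul_div_assoc', mul_comm (k : ℝ), mul_div_mul_right _ _ hk0]
  have hintcast : ∀ (k : ℤ) (x : E), μ ((k : ℝ) • x) = |(k : ℝ)| * μ x := by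
    intro k x
    rcases Int.eq_nat_or_neg k with ⟨n, rfl | rfl⟩
    · simpa using hnat n x
    · simpa [hneg] using hnat n x
  have hden : (t.den : ℝ) ≠ 0 := by exact_mod_cast t.den_nz
  have h1 := hnat t.den ((t : ℝ) • x)
  have h2 : (t.den : ℝ) * t = t.num := by exact_mod_cast Rat.den_mul_eq_num t
  rw [smul_smul, h2, hintcast, ← h2, abs_mul, Nat.abs_cast, mul_assoc] at h1
  exact (mul_left_cancel₀ hden h1).symm

/-- Existence of the time constant for an ergodic random pseudometric with
finite moments; if the law is moreover invariant under the orthogonal group, the time constant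
is constant on the unit sphere. -/
theorem stmt_0 (d : ℕ) (hd : 1 ≤ d) {Ω : Type} [MeasurableSpace Ω]
    (P : Measure Ω) [IsProbabilityMeasure P] (T : Ω → Rd d × Rd d → ℝ)
    (hpseudo : ∀ ω, IsPseudometric (T ω))
    (hmeas : ∀ x y : Rd d, Measurable fun ω => T ω (x, y))
    (herg : ErgodicPM P T) (hmom : FiniteMoments P T) :
    ∃ μ : Rd d → ℝ, IsTimeConstant P T μ ∧
      (IsotropicPM P T → ∀ x y : Rd d, ‖x‖ = 1 → ‖y‖ = 1 → μ x = μ y) := by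
  have hT : Measurable T := measurable_pi_lambda _ fun p => hmeas p.1 p.2
  choose μ hlim hae using herg.exists_tendsto hT hpseudo hmom
  refine ⟨μ, ⟨fun x => ?_, ?_, fun x y => ?_, fun v => ⟨hae v, ?_⟩⟩, fun hiso x y hx hy => ?_⟩
  · exact ge_of_tendsto' (hlim x) fun n =>
      div_nonneg (integral_nonneg fun ω => (hpseudo ω).1 _) n.cast_nonneg
  · exact slope_rat_smul (e := fun x => ∫ ω, T ω (0, x) ∂P) (herg.integral_neg hT hpseudo) hlim
  · refine le_of_tendsto_of_tendsto' (hlim (x + y)) ((hlim x).add (hlim y)) fun n => ?_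
    rw [← add_div, smul_add]
    exact div_le_div_of_nonneg_right (herg.integral_add_le hT hpseudo hmom _ _) n.cast_nonneg
  · refine tendsto_integral_abs_sub_of_nonneg (fun n => (hmom _).div_const _)
      (fun n ω => div_nonneg ((hpseudo ω).1 _) n.cast_nonneg) (hae v) ?_
    simpa only [integral_div] using hlim v
  · let ρ : Rd d ≃ₗᵢ[ℝ] Rd d := (Submodule.span ℝ {x - y})ᗮ.reflection
    have hρ : ρ x = y := Submodule.reflection_sub (hx.trans hy.symm)
    refine tendsto_nhds_unique (hlim x) ((hlim y).congr fun n => ?_)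
    have hρT : Measurable fun ω => fun p : Rd d × Rd d => T ω (ρ p.1, ρ p.2) :=
      measurable_pi_lambda _ fun p => hmeas _ _
    have := integral_apply_eq_of_map_eq hρT hT (hiso ρ) (0, (n : ℝ) • x)
    simp only [map_zero, map_smul, hρ] at this
    rw [this]
end
end

section
/- Let T be a random pseudometric on ℝ^d satisfying annular measurability and decay of instant one-arms with parameters η, R₀ > 0. Then there exists M₀ > 0 such that for every M ≥ M₀ there exists c_M > 0 such that for every c with 0 < c ≤ c_M, P[T(A_M)/M ≤ c] ≤ M^{−(d−1+η/2)}. -/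
open MeasureTheory Filter Set Metric

noncomputable section

variable {Ω : Type} [MeasurableSpace Ω]

def TAnn {d : ℕ} (T : Rd d × Rd d → ℝ) (r R : ℝ) : ℝ :=
  sInf {t | ∃ x y : Rd d, ‖x‖ = r ∧ ‖y‖ = R ∧ t = T (x, y)}

def AnnularMeasurable {d : ℕ} (P : Measure Ω) (T : Ω → Rd d × Rd d → ℝ) : Prop :=
  ∀ r R : ℝ, 0 < r → r < R → Measurable fun ω => TAnn (T ω) r R

def OneArmDecay {d : ℕ} (P : Measure Ω) (T : Ω → Rd d × Rd d → ℝ) (η R₀ : ℝ) : Prop :=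
  ∀ R ≥ R₀, P {ω | TAnn (T ω) 1 R = 0} ≤ ENNReal.ofReal (R ^ (-((d : ℝ) - 1 + η)))

def DecreasingEvent {d : ℕ} (E : Set (Rd d × Rd d → ℝ)) : Prop :=
  ∀ T T' : Rd d × Rd d → ℝ, T ∈ E → (∀ p, T' p ≤ T p) → T' ∈ E

def DependsOnPM {d : ℕ} (E : Set (Rd d × Rd d → ℝ)) (A : Set (Rd d)) : Prop :=
  ∀ T T' : Rd d × Rd d → ℝ, T ∈ E → (∀ p : Rd d × Rd d, p.1 ∈ A → p.2 ∈ A → T' p = T p) → T' ∈ E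

def setDist {d : ℕ} (A B : Set (Rd d)) : ℝ :=
  sInf ((fun p : Rd d × Rd d => dist p.1 p.2) '' (A ×ˢ B))

def IndMinus {d : ℕ} (P : Measure Ω) (T : Ω → Rd d × Rd d → ℝ) (Q S : ℝ) : ℝ :=
  sSup {r : ℝ | ∃ (A B : Set (Rd d)) (EA EB : Set (Rd d × Rd d → ℝ)),
    Metric.diam A ≤ S ∧ Metric.diam B ≤ S ∧ Q < setDist A B ∧
    MeasurableSet EA ∧ MeasurableSet EB ∧
    DecreasingEvent EA ∧ DecreasingEvent EB ∧
    DependsOnPM EA A ∧ DependsOnPM EB B ∧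
    r = |(P (T ⁻¹' (EA ∩ EB))).toReal - (P (T ⁻¹' EA)).toReal * (P (T ⁻¹' EB)).toReal|}

def QuasiIndep {d : ℕ} (P : Measure Ω) (T : Ω → Rd d × Rd d → ℝ) : Prop :=
  ∃ β > 0, ∀ α > 0, ∃ Q₀ : ℝ, ∀ Q ≥ Q₀, IndMinus P T Q (Q ^ (1 + α)) ≤ Real.exp (-(Q ^ β))

/-- If the sublevel set at `0` of a measurable function has measure less than `b`, so does the
sublevel set at some positive level. -/
theorem exists_pos_measure_le_lt {α : Type*} [MeasurableSpace α] (μ : Measure α)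
    [IsFiniteMeasure μ] {f : α → ℝ} (hf : Measurable f) {b : ENNReal}
    (hb : μ {x | f x ≤ 0} < b) : ∃ c : ℝ, 0 < c ∧ μ {x | f x ≤ c} < b := by
  have hanti : Antitone fun n : ℕ => {x | f x ≤ 1 / ((n : ℝ) + 1)} := fun m n hmn x (hx : f x ≤ _) =>
    show f x ≤ _ from hx.trans (Nat.one_div_le_one_div hmn)
  have hinter : ⋂ n : ℕ, {x | f x ≤ 1 / ((n : ℝ) + 1)} = {x | f x ≤ 0} := by
    ext x
    simp only [mem_iInter, mem_ofPred_eq]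
    exact ⟨fun h => ge_of_tendsto' tendsto_one_div_add_atTop_nhds_zero_nat h,
      fun h n => h.trans Nat.one_div_pos_of_nat.le⟩
  have hlim := tendsto_measure_iInter_atTop (μ := μ)
    (s := fun n : ℕ => {x | f x ≤ 1 / ((n : ℝ) + 1)})
    (fun _ => (measurableSet_le hf measurable_const).nullMeasurableSet) hanti ⟨0, measure_ne_top _ _⟩
  rw [hinter] at hlim
  obtain ⟨n, hn⟩ := (hlim.eventually_lt_const hb).exists
  exact ⟨1 / ((n : ℝ) + 1), Nat.one_div_pos_of_nat, hn⟩

theorem TAnn_nonneg {d : ℕ} {T : Rd d × Rd d → ℝ} (hT : IsPseudometric T) (r R : ℝ) :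
    0 ≤ TAnn T r R := by
  apply Real.sInf_nonneg
  rintro t ⟨x, y, -, -, rfl⟩
  exact hT.1 _

/-- Under annular measurability and decay of instant one-arms, for every large
enough scale `M` there is a threshold `c_M > 0` below which the probability of crossing the
annulus `A_M` in time at most `c · M` is at most `M ^ (-(d-1+η/2))`. -/
theorem stmt_5 (d : ℕ) (hd : 1 ≤ d) {Ω : Type} [MeasurableSpace Ω]
    (P : Measure Ω) [IsProbabilityMeasure P] (T : Ω → Rd d × Rd d → ℝ)
    (hpseudo : ∀ ω, IsPseudometric (T ω))
    (hmeas : ∀ x y : Rd d, Measurable fun ω => T ω (x, y))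
    (hann : AnnularMeasurable P T)
    (η R₀ : ℝ) (hη : 0 < η) (hR₀ : 0 < R₀) (hdecay : OneArmDecay P T η R₀) :
    ∃ M₀ : ℝ, 0 < M₀ ∧ ∀ M : ℝ, M₀ ≤ M →
      ∃ cM : ℝ, 0 < cM ∧ ∀ c : ℝ, 0 < c → c ≤ cM →
        P {ω | TAnn (T ω) 1 M / M ≤ c} ≤ ENNReal.ofReal (M ^ (-((d : ℝ) - 1 + η / 2))) := by
  refine ⟨max R₀ 2, by positivity, fun M hM => ?_⟩
  have hM1 : 1 < M := by linarith [le_max_right R₀ 2]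
  have hM0 : 0 < M := by linarith
  have hzero : {ω | TAnn (T ω) 1 M / M ≤ 0} = {ω | TAnn (T ω) 1 M = 0} := by
    ext ω
    simp only [mem_ofPred_eq, div_le_iff₀ hM0, zero_mul]
    exact ⟨fun h => h.antisymm (TAnn_nonneg (hpseudo ω) 1 M), fun h => h.le⟩
  have hlt : P {ω | TAnn (T ω) 1 M / M ≤ 0} <
      ENNReal.ofReal (M ^ (-((d : ℝ) - 1 + η / 2))) := by
    rw [hzero]
    refine (hdecay M ((le_max_left _ _).trans hM)).trans_lt ?_
    rw [ENNReal.ofReal_lt_ofReal_iff (Real.rpow_pos_of_pos hM0 _)]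
    exact Real.rpow_lt_rpow_of_exponent_lt hM1 (by linarith)
  obtain ⟨cM, hcM, hle⟩ :=
    exists_pos_measure_le_lt P ((hann 1 M one_pos hM1).div_const M) hlt
  exact ⟨cM, hcM, fun c _ hc =>
    (measure_mono fun ω (hω : _ ≤ c) => hω.trans hc).trans hle.le⟩
end
end

section
/- Let T be a random pseudometric on ℝ^d that is ergodic, satisfies annular measurability, satisfies T_ω(x,y) ≤ C·‖x−y‖ for some constant C > 0, whose law is invariant under the orthogonal group O(d) acting by (ρ·T)(x,y) = T(ρx, ρy), and which satisfies limsup_{R→∞} P[T(A_{R,2R}) = 0] > 0. Then the time constant μ of T is identically zero. -/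
open MeasureTheory Filter Set Metric

noncomputable section

variable {Ω : Type} [MeasurableSpace Ω]

section TimeConstant

variable {d : ℕ} {P : Measure Ω} {T : Ω → Rd d × Rd d → ℝ}

/-- Two random functions with the same law have the same expectations of one-point functionals. -/
lemma integral_eval_eq_of_map_eq {S : Ω → Rd d × Rd d → ℝ}
    (hS : ∀ p, Measurable fun ω => S ω p) (hT : ∀ p, Measurable fun ω => T ω p)
    (h : Measure.map S P = Measure.map T P) (p : Rd d × Rd d) {f : ℝ → ℝ} (hf : Measurable f) :
    ∫ ω, f (S ω p) ∂P = ∫ ω, f (T ω p) ∂P := by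
  have hid : ProbabilityTheory.IdentDistrib S T P P :=
    ⟨(measurable_pi_iff.2 hS).aemeasurable, (measurable_pi_iff.2 hT).aemeasurable, h⟩
  exact (hid.comp (hf.comp (measurable_pi_apply p))).integral_eq

lemma ErgodicPM.integral_eval_translate (herg : ErgodicPM P T)
    (hT : ∀ p, Measurable fun ω => T ω p) (v x y : Rd d) {f : ℝ → ℝ} (hf : Measurable f) :
    ∫ ω, f (T ω (v + x, v + y)) ∂P = ∫ ω, f (T ω (x, y)) ∂P := by
  rcases eq_or_ne v 0 with rfl | hv
  · simp
  · exact integral_eval_eq_of_map_eq (S := fun ω => shiftT v (T ω)) (fun _ => hT _) hT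
      (herg v hv).1 (x, y) hf

lemma integrable_eval [IsProbabilityMeasure P] (hT : ∀ p, Measurable fun ω => T ω p)
    (hpseudo : ∀ ω, IsPseudometric (T ω)) {C : ℝ}
    (hlip : ∀ ω (x y : Rd d), T ω (x, y) ≤ C * dist x y) (x y : Rd d) :
    Integrable (fun ω => T ω (x, y)) P := by
  refine Integrable.of_bound (hT _).aestronglyMeasurable (C * dist x y) (ae_of_all _ fun ω => ?_)
  rw [Real.norm_of_nonneg ((hpseudo ω).1 _)]
  exact hlip ω x y

/-- The time constant inherits the Lipschitz bound of the pseudometric. -/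
lemma IsTimeConstant.le_mul_norm [IsProbabilityMeasure P] {μ : Rd d → ℝ}
    (hμ : IsTimeConstant P T μ) {C : ℝ}
    (hlip : ∀ ω (x y : Rd d), T ω (x, y) ≤ C * dist x y) (v : Rd d) : μ v ≤ C * ‖v‖ := by
  obtain ⟨ω, hω⟩ := (hμ.2.2.2 v).1.exists
  refine le_of_tendsto hω ((eventually_gt_atTop 0).mono fun n hn => ?_)
  have hn' : (0 : ℝ) < n := by exact_mod_cast hn
  rw [div_le_iff₀ hn']
  refine (hlip ω _ _).trans_eq ?_
  rw [dist_zero_left, norm_smul, Real.norm_of_nonneg hn'.le]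
  ring

lemma IsTimeConstant.real_smul [IsProbabilityMeasure P] {μ : Rd d → ℝ}
    (hμ : IsTimeConstant P T μ) {C : ℝ} (hC : 0 < C)
    (hlip : ∀ ω (x y : Rd d), T ω (x, y) ≤ C * dist x y) (t : ℝ) (v : Rd d) :
    μ (t • v) = |t| * μ v := by
  have hcont : Continuous μ := by
    refine (LipschitzWith.of_le_add_mul C.toNNReal fun x y => ?_).continuous
    have h1 := hμ.2.2.1 y (x - y)
    have h2 := hμ.le_mul_norm hlip (x - y)
    rw [add_sub_cancel] at h1
    rw [Real.coe_toNNReal _ hC.le, dist_eq_norm]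
    linarith
  have h : (fun s : ℝ => μ (s • v)) = fun s => |s| * μ v :=
    Rat.denseRange_cast.equalizer (by fun_prop) (by fun_prop) (funext fun q => hμ.2.1 q v)
  exact congrFun h t

lemma IsTimeConstant.tendsto_integral [IsProbabilityMeasure P] {μ : Rd d → ℝ}
    (hμ : IsTimeConstant P T μ) (hT : ∀ p, Measurable fun ω => T ω p)
    (hpseudo : ∀ ω, IsPseudometric (T ω)) {C : ℝ}
    (hlip : ∀ ω (x y : Rd d), T ω (x, y) ≤ C * dist x y) (v : Rd d) :
    Tendsto (fun n : ℕ => ∫ ω, T ω (0, (n : ℝ) • v) / n ∂P) atTop (nhds (μ v)) := by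
  rw [tendsto_iff_dist_tendsto_zero]
  refine squeeze_zero (fun _ => dist_nonneg) (fun n => ?_) (hμ.2.2.2 v).2
  have hint : Integrable (fun ω => T ω (0, (n : ℝ) • v) / n) P :=
    (integrable_eval hT hpseudo hlip _ _).div_const _
  have h : ∫ ω, (T ω (0, (n : ℝ) • v) / n - μ v) ∂P = ∫ ω, T ω (0, (n : ℝ) • v) / n ∂P - μ v := by
    rw [integral_sub hint (integrable_const _)]
    simp
  rw [Real.dist_eq, ← h]
  exact abs_integral_le_integral_abs

lemma IsTimeConstant.isometry_apply [IsProbabilityMeasure P] {μ : Rd d → ℝ}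
    (hμ : IsTimeConstant P T μ) (hT : ∀ p, Measurable fun ω => T ω p)
    (hpseudo : ∀ ω, IsPseudometric (T ω)) {C : ℝ}
    (hlip : ∀ ω (x y : Rd d), T ω (x, y) ≤ C * dist x y) (hiso : IsotropicPM P T)
    (ρ : Rd d ≃ₗᵢ[ℝ] Rd d) (v : Rd d) : μ (ρ v) = μ v := by
  refine tendsto_nhds_unique (hμ.tendsto_integral hT hpseudo hlip (ρ v))
    ((hμ.tendsto_integral hT hpseudo hlip v).congr fun n => ?_)
  have h := integral_eval_eq_of_map_eq
    (S := fun ω => fun p : Rd d × Rd d => T ω (ρ p.1, ρ p.2)) (fun _ => hT _) hT (hiso ρ)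
    (0, (n : ℝ) • v) (f := fun t => t / n) (by fun_prop)
  simpa using h.symm

/-- The time constant of an isotropic pseudometric is a multiple of the Euclidean norm. -/
lemma IsTimeConstant.norm_mul_eq [IsProbabilityMeasure P] {μ : Rd d → ℝ}
    (hμ : IsTimeConstant P T μ) (hT : ∀ p, Measurable fun ω => T ω p)
    (hpseudo : ∀ ω, IsPseudometric (T ω)) {C : ℝ} (hC : 0 < C)
    (hlip : ∀ ω (x y : Rd d), T ω (x, y) ≤ C * dist x y) (hiso : IsotropicPM P T)
    (v w : Rd d) : ‖w‖ * μ v = ‖v‖ * μ w := by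
  have hnorm : ‖‖w‖ • v‖ = ‖‖v‖ • w‖ := by
    simp [norm_smul, mul_comm]
  have h := hμ.isometry_apply hT hpseudo hlip hiso
    (Submodule.reflection (Submodule.span ℝ {‖w‖ • v - ‖v‖ • w})ᗮ) (‖w‖ • v)
  rw [Submodule.reflection_sub hnorm, hμ.real_smul hC hlip, hμ.real_smul hC hlip, abs_norm,
    abs_norm] at h
  exact h.symm

/-- Between the dilates of two fixed points, `T / n` converges to the time constant in
probability. -/
lemma IsTimeConstant.tendsto_measure [IsProbabilityMeasure P] {μ : Rd d → ℝ}
    (hμ : IsTimeConstant P T μ) (hT : ∀ p, Measurable fun ω => T ω p)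
    (hpseudo : ∀ ω, IsPseudometric (T ω)) {C : ℝ}
    (hlip : ∀ ω (x y : Rd d), T ω (x, y) ≤ C * dist x y) (herg : ErgodicPM P T)
    (x y : Rd d) {ε : ℝ} (hε : 0 < ε) :
    Tendsto (fun n : ℕ => P {ω | ε ≤ |T ω ((n : ℝ) • x, (n : ℝ) • y) / n - μ (y - x)|})
      atTop (nhds 0) := by
  have hlim : Tendsto (fun n : ℕ => ENNReal.ofReal
      ((∫ ω, |T ω (0, (n : ℝ) • (y - x)) / n - μ (y - x)| ∂P) / ε)) atTop (nhds 0) := by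
    simpa using ENNReal.tendsto_ofReal ((hμ.2.2.2 (y - x)).2.div_const ε)
  refine tendsto_of_tendsto_of_tendsto_of_le_of_le tendsto_const_nhds hlim
    (fun _ => zero_le) fun n => ?_
  have hint : Integrable (fun ω => |T ω ((n : ℝ) • x, (n : ℝ) • y) / n - μ (y - x)|) P :=
    (((integrable_eval hT hpseudo hlip _ _).div_const _).sub (integrable_const _)).abs
  have hmarkov := mul_meas_ge_le_integral_of_nonneg (ae_of_all _ fun ω => abs_nonneg _) hint ε
  have htrans := herg.integral_eval_translate hT ((n : ℝ) • x) 0 ((n : ℝ) • (y - x))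
    (f := fun t => |t / n - μ (y - x)|) (by fun_prop)
  rw [add_zero, ← smul_add, add_sub_cancel] at htrans
  dsimp only at htrans ⊢
  rw [← htrans, ← ENNReal.ofReal_toReal (measure_ne_top P _)]
  refine ENNReal.ofReal_le_ofReal ?_
  rw [le_div_iff₀ hε, mul_comm]
  exact hmarkov

end TimeConstant

/-- If an ergodic, Lipschitz, isotropic random pseudometric has instant
crossings of large rescaled annuli with non-vanishing probability, then its time constant
vanishes identically. -/
theorem stmt_9 (d : ℕ) (hd : 1 ≤ d) {Ω : Type} [MeasurableSpace Ω]
    (P : Measure Ω) [IsProbabilityMeasure P] (T : Ω → Rd d × Rd d → ℝ)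
    (hpseudo : ∀ ω, IsPseudometric (T ω))
    (hmeas : ∀ x y : Rd d, Measurable fun ω => T ω (x, y))
    (herg : ErgodicPM P T)
    (hann : AnnularMeasurable P T)
    (C : ℝ) (hC : 0 < C) (hlip : ∀ ω (x y : Rd d), T ω (x, y) ≤ C * dist x y)
    (hiso : IsotropicPM P T)
    (hcross : 0 < Filter.limsup (fun R : ℝ => P {ω | TAnn (T ω) R (2 * R) = 0}) atTop)
    (μ : Rd d → ℝ) (hμ : IsTimeConstant P T μ) :
    ∀ x : Rd d, μ x = 0 := by
  by_contra! ⟨x₀, hx₀⟩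
  have hT : ∀ p, Measurable fun ω => T ω p := fun p => hmeas p.1 p.2
  have hx₀pos : 0 < μ x₀ := (hμ.1 x₀).lt_of_ne' hx₀
  have hnx₀ : 0 < ‖x₀‖ := by
    rw [norm_pos_iff]
    rintro rfl
    exact hx₀ (by simpa using hμ.2.1 0 0)
  set k := μ x₀ / ‖x₀‖ with hk
  have hkpos : 0 < k := div_pos hx₀pos hnx₀
  have hμk : ∀ z, μ z = k * ‖z‖ := fun z => by
    have h := hμ.norm_mul_eq hT hpseudo hC hlip hiso z x₀
    rw [hk]
    field_simp
    linarith
  have hsphere : ∀ r : ℝ, 0 ≤ r → ∃ z : Rd d, ‖z‖ = r := fun r hr =>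
    ⟨(r / ‖x₀‖) • x₀, by
      rw [norm_smul, Real.norm_of_nonneg (by positivity), div_mul_cancel₀ _ hnx₀.ne']⟩
  set ε := k / (12 * C) with hε
  have hεpos : 0 < ε := by positivity
  obtain ⟨s, hs, hsfin, hscover⟩ := (isCompact_sphere (0 : Rd d) 1).finite_cover_balls hεpos
  obtain ⟨t, ht, htfin, htcover⟩ := (isCompact_sphere (0 : Rd d) 2).finite_cover_balls hεpos
  refine hcross.ne' (Tendsto.limsup_eq ?_)
  have hsum : Tendsto (fun R : ℝ => ∑ p ∈ hsfin.toFinset ×ˢ htfin.toFinset,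
      P {ω | k / 2 ≤ |T ω ((⌊R⌋₊ : ℝ) • p.1, (⌊R⌋₊ : ℝ) • p.2) / ⌊R⌋₊ - μ (p.2 - p.1)|})
      atTop (nhds 0) := by
    have h := tendsto_finsetSum (hsfin.toFinset ×ˢ htfin.toFinset) fun p _ =>
      (hμ.tendsto_measure hT hpseudo hlip herg p.1 p.2 (half_pos hkpos)).comp
        (tendsto_nat_floor_atTop (α := ℝ))
    simpa only [Finset.sum_const_zero, Function.comp_def] using h
  refine tendsto_of_tendsto_of_tendsto_of_le_of_le' tendsto_const_nhds hsum
    (Eventually.of_forall fun _ => zero_le) ?_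
  filter_upwards [eventually_gt_atTop 0,
    tendsto_nat_floor_atTop.eventually (tendsto_natCast_atTop_atTop.eventually_ge_atTop (4 / ε)),
    tendsto_nat_floor_atTop.eventually (eventually_gt_atTop 0)] with R hR hlarge hfloor
  have hn : (0 : ℝ) < ⌊R⌋₊ := by exact_mod_cast hfloor
  refine (measure_mono fun ω hω => ?_).trans (measure_biUnion_finset_le _ _)
  obtain ⟨a, ha⟩ := hsphere R hR.le
  obtain ⟨b, hb⟩ := hsphere (2 * R) (by positivity)
  have hzero : TAnn (T ω) R (2 * R) = 0 := hω
  obtain ⟨_, ⟨x', y', hx', hy', rfl⟩, hlt⟩ :=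
    exists_lt_of_csInf_lt (s := {t | ∃ x y : Rd d, ‖x‖ = R ∧ ‖y‖ = 2 * R ∧ t = T ω (x, y)})
      ⟨_, a, b, ha, hb, rfl⟩ (hzero.trans_lt hC)
  have hscale : ∀ z : Rd d, R • R⁻¹ • z = z := fun z => smul_inv_smul₀ hR.ne' z
  have hnx : ‖R⁻¹ • x'‖ = 1 := by
    rw [norm_smul, hx', norm_inv, Real.norm_of_nonneg hR.le, inv_mul_cancel₀ hR.ne']
  have hny : ‖R⁻¹ • y'‖ = 2 := by
    rw [norm_smul, hy', norm_inv, Real.norm_of_nonneg hR.le]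
    field_simp
  rw [← hscale x', ← hscale y'] at hlt
  generalize R⁻¹ • x' = x at hnx hlt
  generalize R⁻¹ • y' = y at hny hlt
  obtain ⟨p, hp, hxp⟩ := mem_iUnion₂.1 (hscover (mem_sphere_zero_iff_norm.2 hnx))
  obtain ⟨q, hq, hyq⟩ := mem_iUnion₂.1 (htcover (mem_sphere_zero_iff_norm.2 hny))
  rw [mem_iUnion₂]
  refine ⟨(p, q), by simp [hp, hq], ?_⟩
  obtain ⟨-, -, hsymm, htri⟩ := hpseudo ω
  have hdil : ∀ z : Rd d, T ω ((⌊R⌋₊ : ℝ) • z, R • z) ≤ C * ‖z‖ := fun z => by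
    refine (hlip ω _ _).trans (mul_le_mul_of_nonneg_left ?_ hC.le)
    rw [dist_eq_norm, ← sub_smul, norm_smul]
    refine mul_le_of_le_one_left (norm_nonneg _) ?_
    rw [Real.norm_eq_abs, abs_le]
    constructor <;> linarith [Nat.floor_le hR.le, Nat.lt_floor_add_one R]
  have hclose : ∀ z w : Rd d, dist z w < ε →
      T ω ((⌊R⌋₊ : ℝ) • z, (⌊R⌋₊ : ℝ) • w) ≤ C * (⌊R⌋₊ * ε) := fun z w h => by
    refine (hlip ω _ _).trans (mul_le_mul_of_nonneg_left ?_ hC.le)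
    rw [dist_smul₀, Real.norm_of_nonneg hn.le]
    exact mul_le_mul_of_nonneg_left h.le hn.le
  have hpq : T ω ((⌊R⌋₊ : ℝ) • p, (⌊R⌋₊ : ℝ) • q) ≤ C * (3 * (⌊R⌋₊ * ε)) := by
    have h1 := hclose p x (by rwa [dist_comm])
    have h2 := hdil x
    have h3 := hdil y
    have h4 := hclose y q hyq
    rw [hnx] at h2
    rw [hny, hsymm] at h3
    have h5 : C * 4 ≤ C * (⌊R⌋₊ * ε) :=
      mul_le_mul_of_nonneg_left ((div_le_iff₀ hεpos).1 hlarge) hC.le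
    have t1 := htri ((⌊R⌋₊ : ℝ) • p) ((⌊R⌋₊ : ℝ) • x) ((⌊R⌋₊ : ℝ) • q)
    have t2 := htri ((⌊R⌋₊ : ℝ) • x) (R • x) ((⌊R⌋₊ : ℝ) • q)
    have t3 := htri (R • x) (R • y) ((⌊R⌋₊ : ℝ) • q)
    have t4 := htri (R • y) ((⌊R⌋₊ : ℝ) • y) ((⌊R⌋₊ : ℝ) • q)
    linarith
  have hquot : T ω ((⌊R⌋₊ : ℝ) • p, (⌊R⌋₊ : ℝ) • q) / ⌊R⌋₊ ≤ k / 4 := by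
    rw [div_le_iff₀ hn]
    refine hpq.trans_eq ?_
    rw [hε]
    field_simp
    norm_num
  have hμpq : k ≤ μ (q - p) := by
    have h1 := norm_sub_norm_le q p
    rw [mem_sphere_zero_iff_norm.1 (hs hp), mem_sphere_zero_iff_norm.1 (ht hq)] at h1
    rw [hμk]
    exact le_mul_of_one_le_right hkpos.le (by linarith)
  rw [mem_ofPred_eq, abs_sub_comm]
  exact le_trans (by linarith) (le_abs_self _)
end
end

section
/- Let g be a random continuous Riemannian metric on ℝ^d that is ergodic, satisfies the weak finite moment condition E[√(⟨g(0)·v, v⟩)] < ∞ for every v ∈ ℝ^d, has measurable evaluations ω ↦ T_g(x,y) and ω ↦ T_g(A_{r,R}), and has finite range: there exists Q > 0 such that for any two subsets A, B ⊆ ℝ^d with dist(A,B) ≥ Q, the σ-algebra generated by the family (g(x))_{x∈A} and the σ-algebra generated by (g(y))_{y∈B} are independent. Then the time constant μ of T_g satisfies μ(v) > 0 for every v ≠ 0; that is, μ is a norm on ℝ^d. -/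
open MeasureTheory Filter Set Metric Matrix

noncomputable section

def IsPiecewiseC1On {d : ℕ} (γ : ℝ → Rd d) (a b : ℝ) : Prop :=
  ContinuousOn γ (Set.Icc a b) ∧
  ∃ (n : ℕ) (t : Fin (n + 1) → ℝ), t 0 = a ∧ t (Fin.last n) = b ∧ Monotone t ∧
    ∀ i : Fin n, ContDiffOn ℝ 1 γ (Set.Icc (t i.castSucc) (t i.succ))

/-- The `g`-length of a path `γ : [0,1] → ℝ^d`. -/
def gLength {d : ℕ} (g : Rd d → Matrix (Fin d) (Fin d) ℝ) (γ : ℝ → Rd d) : ℝ :=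
  ∫ s in (0:ℝ)..1,
    Real.sqrt ((g (γ s)).mulVec (fun i => deriv γ s i) ⬝ᵥ (fun i => deriv γ s i))

/-- The Riemannian distance associated with `g`. -/
def Tg {d : ℕ} (g : Rd d → Matrix (Fin d) (Fin d) ℝ) (x y : Rd d) : ℝ :=
  sInf {r | ∃ γ : ℝ → Rd d, IsPiecewiseC1On γ 0 1 ∧ γ 0 = x ∧ γ 1 = y ∧ r = gLength g γ}

def TgAnn {d : ℕ} (g : Rd d → Matrix (Fin d) (Fin d) ℝ) (r R : ℝ) : ℝ :=
  sInf {t | ∃ x y : Rd d, ‖x‖ = r ∧ ‖y‖ = R ∧ t = Tg g x y}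

def shiftG {d : ℕ} (v : Rd d) (g : Rd d → Matrix (Fin d) (Fin d) ℝ) :
    Rd d → Matrix (Fin d) (Fin d) ℝ := fun x => g (v + x)

instance matrixMeasurableSpace {d : ℕ} : MeasurableSpace (Matrix (Fin d) (Fin d) ℝ) :=
  (inferInstance : MeasurableSpace (Fin d → Fin d → ℝ))

variable {Ω : Type} [MeasurableSpace Ω]

def ErgodicMetric {d : ℕ} (P : Measure Ω) (g : Ω → Rd d → Matrix (Fin d) (Fin d) ℝ) : Prop :=
  ∀ v : Rd d, v ≠ 0 →
    (Measure.map (fun ω => shiftG v (g ω)) P = Measure.map g P) ∧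
    ∀ E : Set (Rd d → Matrix (Fin d) (Fin d) ℝ), MeasurableSet E → shiftG v ⁻¹' E = E →
      P (g ⁻¹' E) = 0 ∨ P (g ⁻¹' E) = 1

/-- Weak finite moment condition: `E[√(⟨g(0)v, v⟩)] < ∞` for every `v`. -/
def WeakFiniteMoment {d : ℕ} (P : Measure Ω) (g : Ω → Rd d → Matrix (Fin d) (Fin d) ℝ) : Prop :=
  ∀ v : Rd d,
    ∫⁻ ω, ENNReal.ofReal (Real.sqrt ((g ω 0).mulVec (fun i => v i) ⬝ᵥ (fun i => v i))) ∂P < ⊤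

def IsTimeConstantG {d : ℕ} (P : Measure Ω) (g : Ω → Rd d → Matrix (Fin d) (Fin d) ℝ)
    (μ : Rd d → ℝ) : Prop :=
  (∀ x, 0 ≤ μ x) ∧
  (∀ (t : ℚ) (x : Rd d), μ ((t : ℝ) • x) = |(t : ℝ)| * μ x) ∧
  (∀ x y, μ (x + y) ≤ μ x + μ y) ∧
  ∀ v : Rd d,
    (∀ᵐ ω ∂P, Tendsto (fun n : ℕ => Tg (g ω) 0 ((n : ℝ) • v) / n) atTop (nhds (μ v))) ∧
    Tendsto (fun n : ℕ => ∫ ω, |Tg (g ω) 0 ((n : ℝ) • v) / n - μ v| ∂P) atTop (nhds 0)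

/-- `Ind⁻(Q,S)`, computed for the random pseudometric `T_g`. -/
def IndMinusG {d : ℕ} (P : Measure Ω) (g : Ω → Rd d → Matrix (Fin d) (Fin d) ℝ)
    (Q S : ℝ) : ℝ :=
  sSup {r : ℝ | ∃ (A B : Set (Rd d)) (EA EB : Set (Rd d × Rd d → ℝ)),
    Metric.diam A ≤ S ∧ Metric.diam B ≤ S ∧ Q < setDist A B ∧
    MeasurableSet EA ∧ MeasurableSet EB ∧
    DecreasingEvent EA ∧ DecreasingEvent EB ∧
    DependsOnPM EA A ∧ DependsOnPM EB B ∧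
    r = |(P ((fun ω => fun p : Rd d × Rd d => Tg (g ω) p.1 p.2) ⁻¹' (EA ∩ EB))).toReal -
          (P ((fun ω => fun p : Rd d × Rd d => Tg (g ω) p.1 p.2) ⁻¹' EA)).toReal *
            (P ((fun ω => fun p : Rd d × Rd d => Tg (g ω) p.1 p.2) ⁻¹' EB)).toReal|}


theorem IsPiecewiseC1On.exists_partition {d : ℕ} {γ : ℝ → Rd d} {a b : ℝ}
    (hγ : IsPiecewiseC1On γ a b) :
    ∃ (n : ℕ) (t : ℕ → ℝ), t 0 = a ∧ t n = b ∧ Monotone t ∧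
      ∀ k < n, ContDiffOn ℝ 1 γ (Icc (t k) (t (k + 1))) := by
  obtain ⟨-, n, t, h0, h1, hmono, hC⟩ := hγ
  refine ⟨n, fun k => t ⟨min k n, by omega⟩, ?_, ?_, ?_, ?_⟩
  · simpa using h0
  · simpa [Fin.last] using h1
  · intro i j hij
    apply hmono
    simp only [Fin.mk_le_mk]
    omega
  · intro k hk
    have := hC ⟨k, hk⟩
    have e0 : (⟨min k n, by omega⟩ : Fin (n + 1)) = Fin.castSucc ⟨k, hk⟩ := by
      ext; simp; omega
    have e1 : (⟨min (k + 1) n, by omega⟩ : Fin (n + 1)) = Fin.succ ⟨k, hk⟩ := by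
      ext; simp; omega
    simpa only [e0, e1] using this

theorem derivWithin_Icc_eq_deriv {d : ℕ} {γ : ℝ → Rd d} {a b x : ℝ} (hx : x ∈ Ioo a b) :
    derivWithin γ (Icc a b) x = deriv γ x :=
  derivWithin_of_mem_nhds (Icc_mem_nhds hx.1 hx.2)

/-- A continuous function of position and velocity is integrable along a piecewise `C¹` path. -/
theorem IsPiecewiseC1On.intervalIntegrable_comp {d : ℕ} {E : Type*} [NormedAddCommGroup E]
    {γ : ℝ → Rd d} {a b : ℝ} (hγ : IsPiecewiseC1On γ a b)
    {F : Rd d → Rd d → E} (hF : Continuous fun p : Rd d × Rd d => F p.1 p.2) :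
    IntervalIntegrable (fun s => F (γ s) (deriv γ s)) volume a b := by
  obtain ⟨n, t, rfl, rfl, hmono, hC⟩ := hγ.exists_partition
  apply IntervalIntegrable.trans_iterate
  intro k hk
  rcases (hmono (Nat.le_succ k)).eq_or_lt with heq | hlt
  · rw [Nat.succ_eq_add_one] at heq
    rw [← heq]
  · rw [Nat.succ_eq_add_one] at hlt
    have hc : ContinuousOn (fun s => F (γ s) (derivWithin γ (Icc (t k) (t (k + 1))) s))
        (Icc (t k) (t (k + 1))) :=
      hF.comp_continuousOn ((hC k hk).continuousOn.prodMk
        ((hC k hk).continuousOn_derivWithin (uniqueDiffOn_Icc hlt) le_rfl))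
    refine (ContinuousOn.intervalIntegrable_of_Icc hlt.le hc).congr_uIoo ?_
    intro x hx
    rw [uIoo_of_le hlt.le] at hx
    simp only [derivWithin_Icc_eq_deriv hx]

theorem IsPiecewiseC1On.exists_countable_differentiableAt {d : ℕ} {γ : ℝ → Rd d} {a b : ℝ}
    (hγ : IsPiecewiseC1On γ a b) :
    ∃ S : Set ℝ, S.Countable ∧ ∀ x ∈ Ioo a b \ S, DifferentiableAt ℝ γ x := by
  obtain ⟨n, t, rfl, rfl, hmono, hC⟩ := hγ.exists_partition
  refine ⟨range t, countable_range t, ?_⟩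
  rintro x ⟨⟨h0, h1⟩, hxS⟩
  have hex : ∃ k, x < t k := ⟨n, h1⟩
  classical
  have hk := Nat.find_spec hex
  have hkn : Nat.find hex ≤ n := Nat.find_min' hex h1
  have hk0 : Nat.find hex ≠ 0 := by
    intro h
    rw [h] at hk
    exact absurd hk h0.not_gt
  obtain ⟨k, hkk⟩ := Nat.exists_eq_succ_of_ne_zero hk0
  have hlt : ¬ x < t k := Nat.find_min hex (by omega)
  have hne : t k ≠ x := fun h => hxS ⟨k, h⟩
  rw [hkk] at hk
  have hx : x ∈ Ioo (t k) (t (k + 1)) := ⟨lt_of_le_of_ne (not_lt.1 hlt) hne, hk⟩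
  exact ((hC k (by omega)).differentiableOn one_ne_zero).differentiableAt
    (Icc_mem_nhds hx.1 hx.2)

theorem IsPiecewiseC1On.norm_sub_le_integral {d : ℕ} {γ : ℝ → Rd d} {a b s t : ℝ}
    (hγ : IsPiecewiseC1On γ a b) (has : a ≤ s) (hst : s ≤ t) (htb : t ≤ b) :
    ‖γ t - γ s‖ ≤ ∫ x in s..t, ‖deriv γ x‖ := by
  obtain ⟨S, hS, hdiff⟩ := hγ.exists_countable_differentiableAt
  have hint : IntervalIntegrable (deriv γ) volume s t := by
    refine (hγ.intervalIntegrable_comp (F := fun _ v => v) continuous_snd).mono_set ?_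
    rw [uIcc_of_le hst, uIcc_of_le (has.trans (hst.trans htb))]
    exact Icc_subset_Icc has htb
  rw [← MeasureTheory.integral_eq_of_hasDerivAt_off_countable_of_le γ (deriv γ) hst hS
    (hγ.1.mono (Icc_subset_Icc has htb))
    (fun x hx => (hdiff x ⟨⟨has.trans_lt hx.1.1, hx.1.2.trans_le htb⟩, hx.2⟩).hasDerivAt) hint]
  exact intervalIntegral.norm_integral_le_integral_norm hst

/-- The quadratic form `u ↦ ⟨A u, u⟩`. -/
def quadForm {d : ℕ} (A : Matrix (Fin d) (Fin d) ℝ) (u : Rd d) : ℝ :=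
  A.mulVec (fun i => u i) ⬝ᵥ (fun i => u i)

theorem quadForm_eq_sum {d : ℕ} (A : Matrix (Fin d) (Fin d) ℝ) (u : Rd d) :
    quadForm A u = ∑ i, (∑ j, A i j * u j) * u i := rfl

theorem continuous_quadForm {d : ℕ} :
    Continuous fun p : Matrix (Fin d) (Fin d) ℝ × Rd d => quadForm p.1 p.2 := by
  simp only [quadForm_eq_sum]
  have hA (i j : Fin d) : Continuous fun p : Matrix (Fin d) (Fin d) ℝ × Rd d => p.1 i j :=
    (continuous_apply_apply i j).comp continuous_fst
  fun_prop

theorem quadForm_pos {d : ℕ} {A : Matrix (Fin d) (Fin d) ℝ} (hA : A.PosDef) {u : Rd d}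
    (hu : u ≠ 0) : 0 < quadForm A u := by
  have h := hA.dotProduct_mulVec_pos (x := fun i => u i) (by
    intro h
    apply hu
    ext i
    exact congrFun h i)
  rw [dotProduct_comm] at h
  simpa [quadForm] using h

theorem quadForm_smul {d : ℕ} (A : Matrix (Fin d) (Fin d) ℝ) (c : ℝ) (u : Rd d) :
    quadForm A (c • u) = c ^ 2 * quadForm A u := by
  simp only [quadForm_eq_sum, PiLp.smul_apply, smul_eq_mul, Finset.sum_mul, Finset.mul_sum]
  refine Finset.sum_congr rfl fun i _ => Finset.sum_congr rfl fun j _ => ?_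
  ring

theorem IsPiecewiseC1On.intervalIntegrable_speed {d : ℕ}
    {g : Rd d → Matrix (Fin d) (Fin d) ℝ} (hg : Continuous g) {γ : ℝ → Rd d} {a b : ℝ}
    (hγ : IsPiecewiseC1On γ a b) :
    IntervalIntegrable (fun s => Real.sqrt (quadForm (g (γ s)) (deriv γ s))) volume a b :=
  hγ.intervalIntegrable_comp (F := fun x v => Real.sqrt (quadForm (g x) v))
    (Real.continuous_sqrt.comp (continuous_quadForm.comp
      ((hg.comp continuous_fst).prodMk continuous_snd)))

/-- Crossing an annulus of unit width on which `g ≥ δ` costs at least `√δ`. -/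
theorem IsPiecewiseC1On.sqrt_le_integral_speed {d : ℕ}
    {g : Rd d → Matrix (Fin d) (Fin d) ℝ} (hg : Continuous g) {γ : ℝ → Rd d} {a b s t : ℝ}
    (hγ : IsPiecewiseC1On γ a b) (has : a ≤ s) (hst : s ≤ t) (htb : t ≤ b)
    {c : Rd d} {r δ : ℝ} (hδ : 0 ≤ δ)
    (hgood : ∀ x ∈ ball c (r + 1), ∀ u, δ * ‖u‖ ^ 2 ≤ quadForm (g x) u)
    (hs : ‖γ s - c‖ ≤ r) (ht : r + 1 ≤ ‖γ t - c‖) :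
    Real.sqrt δ ≤ ∫ x in s..t, Real.sqrt (quadForm (g (γ x)) (deriv γ x)) := by
  have hsub : Icc s t ⊆ Icc a b := Icc_subset_Icc has htb
  have hcomp : IsCompact {x ∈ Icc s t | r + 1 ≤ ‖γ x - c‖} := by
    have : IsClosed (Icc s t ∩ (fun x => ‖γ x - c‖) ⁻¹' Ici (r + 1)) :=
      (((hγ.1.mono hsub).sub continuousOn_const).norm).preimage_isClosed_of_isClosed
        isClosed_Icc isClosed_Ici
    exact isCompact_Icc.of_isClosed_subset this inter_subset_left
  obtain ⟨τ, ⟨hτ, hτr⟩, hτmin⟩ := hcomp.exists_isLeast ⟨t, right_mem_Icc.2 hst, ht⟩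
  have hspeed := hγ.intervalIntegrable_speed hg
  have hab : a ≤ b := has.trans (hst.trans htb)
  have hnorm : IntervalIntegrable (fun x => ‖deriv γ x‖) volume a b :=
    hγ.intervalIntegrable_comp (F := fun _ v => ‖v‖) continuous_snd.norm
  have hmono {p q : ℝ} (hp : a ≤ p) (hpq : p ≤ q) (hq : q ≤ b) : uIcc p q ⊆ uIcc a b := by
    rw [uIcc_of_le hpq, uIcc_of_le hab]
    exact Icc_subset_Icc hp hq
  have hτb : τ ≤ b := hτ.2.trans htb
  have h1 : 1 ≤ ‖γ τ - γ s‖ := by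
    have := norm_sub_norm_le (γ τ - c) (γ s - c)
    rw [sub_sub_sub_cancel_right] at this
    linarith
  calc Real.sqrt δ = Real.sqrt δ * 1 := (mul_one _).symm
    _ ≤ Real.sqrt δ * ∫ x in s..τ, ‖deriv γ x‖ :=
        mul_le_mul_of_nonneg_left (h1.trans (hγ.norm_sub_le_integral has hτ.1 hτb))
          (Real.sqrt_nonneg _)
    _ = ∫ x in s..τ, Real.sqrt δ * ‖deriv γ x‖ :=
        (intervalIntegral.integral_const_mul _ _).symm
    _ ≤ ∫ x in s..τ, Real.sqrt (quadForm (g (γ x)) (deriv γ x)) := by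
        refine intervalIntegral.integral_mono_on_of_le_Ioo hτ.1
          ((hnorm.mono_set (hmono has hτ.1 hτb)).const_mul _)
          (hspeed.mono_set (hmono has hτ.1 hτb)) ?_
        intro x hx
        have hxball : γ x ∈ ball c (r + 1) := by
          rw [mem_ball_iff_norm]
          by_contra hcon
          exact absurd (hτmin ⟨⟨hx.1.le, hx.2.le.trans hτ.2⟩, not_lt.1 hcon⟩) hx.2.not_ge
        rw [← Real.sqrt_sq (norm_nonneg (deriv γ x)), ← Real.sqrt_mul hδ]
        exact Real.sqrt_le_sqrt (hgood _ hxball _)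
    _ ≤ ∫ x in s..t, Real.sqrt (quadForm (g (γ x)) (deriv γ x)) :=
        intervalIntegral.integral_mono_interval le_rfl hτ.1 hτ.2
          (Eventually.of_forall fun _ => Real.sqrt_nonneg _)
          (hspeed.mono_set (hmono has hst htb))

theorem tgSet_nonempty {d : ℕ} (g : Rd d → Matrix (Fin d) (Fin d) ℝ) (x y : Rd d) :
    {r | ∃ γ : ℝ → Rd d, IsPiecewiseC1On γ 0 1 ∧ γ 0 = x ∧ γ 1 = y ∧
      r = gLength g γ}.Nonempty := by
  refine ⟨_, fun s => x + s • (y - x), ⟨by fun_prop, 1, ![0, 1], rfl, rfl, ?_, ?_⟩, by simp,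
    by simp, rfl⟩
  · intro i j hij
    fin_cases i <;> fin_cases j <;> simp_all
  · intro i
    fun_prop

/-- The point of `ℝ^d` with the given integer coordinates. -/
def latticePoint {d : ℕ} (z : Fin d → ℤ) : Rd d := WithLp.toLp 2 fun i => (z i : ℝ)

/-- Coordinatewise rounding to the integer lattice. -/
def roundVec {d : ℕ} (x : Rd d) : Fin d → ℤ := fun i => round (x i)

theorem norm_sub_latticePoint_roundVec_le {d : ℕ} (x : Rd d) :
    ‖x - latticePoint (roundVec x)‖ ≤ d := by
  rw [EuclideanSpace.norm_eq]
  apply Real.sqrt_le_iff.2 ⟨Nat.cast_nonneg d, ?_⟩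
  calc ∑ i, ‖(x - latticePoint (roundVec x)) i‖ ^ 2 ≤ ∑ _i : Fin d, (1 : ℝ) := by
        refine Finset.sum_le_sum fun i _ => ?_
        have h : ‖(x - latticePoint (roundVec x)) i‖ ≤ 1 / 2 := abs_sub_round (x i)
        nlinarith [norm_nonneg ((x - latticePoint (roundVec x)) i)]
    _ = d := by simp
    _ ≤ (d : ℝ) ^ 2 := by exact_mod_cast Nat.le_self_pow two_ne_zero d

theorem abs_coord_sub_le {d : ℕ} (z w : Fin d → ℤ) (i : Fin d) :
    (|z i - w i| : ℝ) ≤ ‖latticePoint z - latticePoint w‖ :=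
  PiLp.norm_apply_le (latticePoint z - latticePoint w) i

/-- The last visit of a path to a closed ball. -/
theorem exists_last_visit {d : ℕ} {γ : ℝ → Rd d} (hγ : ContinuousOn γ (Icc 0 1)) (c : Rd d)
    {R σ : ℝ} (hσ : σ ∈ Icc (0 : ℝ) 1) (hin : ‖γ σ - c‖ ≤ R) :
    ∃ τ ∈ Icc σ 1, ‖γ τ - c‖ ≤ R ∧
      (R < ‖γ 1 - c‖ → ∀ s ∈ Icc τ 1, R ≤ ‖γ s - c‖) := by
  have hcont : ContinuousOn (fun s => ‖γ s - c‖) (Icc 0 1) :=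
    (hγ.sub continuousOn_const).norm
  have hK : IsCompact (Icc (0 : ℝ) 1 ∩ (fun s => ‖γ s - c‖) ⁻¹' Iic R) :=
    isCompact_Icc.of_isClosed_subset
      (hcont.preimage_isClosed_of_isClosed isClosed_Icc isClosed_Iic) inter_subset_left
  obtain ⟨τ, ⟨hτ, hτR⟩, hmax⟩ := hK.exists_isGreatest ⟨σ, hσ, hin⟩
  refine ⟨τ, ⟨hmax ⟨hσ, hin⟩, hτ.2⟩, hτR, fun h1 s hs => ?_⟩
  have hafter : ∀ s ∈ Ioc τ 1, R < ‖γ s - c‖ := fun s hs => by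
    by_contra hcon
    exact absurd (hmax ⟨⟨hτ.1.trans hs.1.le, hs.2⟩, not_lt.1 hcon⟩) hs.1.not_ge
  rcases hs.1.eq_or_lt with rfl | hlt
  · have hτ1 : τ < 1 := lt_of_le_of_ne hτ.2 fun h => by
      rw [h] at hτR
      exact absurd hτR (not_le.2 h1)
    have hlim : Tendsto (fun s => ‖γ s - c‖) (nhdsWithin τ (Ioc τ 1)) (nhds ‖γ τ - c‖) :=
      (hcont τ hτ).mono_left (nhdsWithin_mono _ fun x hx => ⟨hτ.1.trans hx.1.le, hx.2⟩)
    have : (nhdsWithin τ (Ioc τ 1)).NeBot := by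
      rw [nhdsWithin_Ioc_eq_nhdsGT hτ1]
      infer_instance
    exact ge_of_tendsto hlim (eventually_nhdsWithin_of_forall fun s hs => (hafter s hs).le)
  · exact (hafter s ⟨hlt, hs.2⟩).le

/-- Successive last visits of a path to balls of radius `R` around lattice points. -/
theorem exists_last_visits {d : ℕ} {γ : ℝ → Rd d} (hγ : ContinuousOn γ (Icc 0 1)) {R : ℝ}
    (hR : (d : ℝ) ≤ R) :
    ∃ σ : ℕ → ℝ, Monotone σ ∧ σ 0 = 0 ∧ (∀ k, σ k ∈ Icc (0 : ℝ) 1) ∧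
      ∀ k, ‖γ (σ (k + 1)) - latticePoint (roundVec (γ (σ k)))‖ ≤ R ∧
        (R < ‖γ 1 - latticePoint (roundVec (γ (σ k)))‖ →
          ∀ s ∈ Icc (σ (k + 1)) 1, R ≤ ‖γ s - latticePoint (roundVec (γ (σ k)))‖) := by
  have hex (σ : Icc (0 : ℝ) 1) := exists_last_visit hγ (latticePoint (roundVec (γ σ))) σ.2
    ((norm_sub_latticePoint_roundVec_le (γ σ)).trans hR)
  choose f hf hfR hfafter using hex
  let F : Icc (0 : ℝ) 1 → Icc (0 : ℝ) 1 := fun σ => ⟨f σ, σ.2.1.trans (hf σ).1, (hf σ).2⟩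
  let σ : ℕ → Icc (0 : ℝ) 1 := fun k => F^[k] ⟨0, by simp⟩
  have hσ (k : ℕ) : (σ (k + 1) : ℝ) = f (σ k) := by
    simp only [σ, Function.iterate_succ_apply', F]
  refine ⟨fun k => σ k, monotone_nat_of_le_succ fun k => ?_, rfl, fun k => (σ k).2, fun k => ?_⟩
  · rw [hσ]; exact (hf _).1
  · simp only [hσ]
    exact ⟨hfR _, hfafter _⟩

/-- Lattice vectors all of whose coordinates are bounded by `M`. -/
def latticeBox (d M : ℕ) : Finset (Fin d → ℤ) :=
  Fintype.piFinset fun _ => Finset.Icc (-(M : ℤ)) M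

/-- The lattice walk with the given steps, started at the origin. -/
def walkOfSteps {d m M : ℕ} (e : Fin m → latticeBox d M) (k : ℕ) : Fin d → ℤ :=
  ∑ i : Fin m, if (i : ℕ) < k then (e i : Fin d → ℤ) else 0

theorem exists_walkOfSteps_eq {d m M : ℕ} (z : ℕ → Fin d → ℤ) (h0 : z 0 = 0)
    (hz : ∀ k < m, z (k + 1) - z k ∈ latticeBox d M) :
    ∃ e : Fin m → latticeBox d M, ∀ k ≤ m, walkOfSteps e k = z k := by
  refine ⟨fun i => ⟨z (i + 1) - z i, hz i i.2⟩, fun k hk => ?_⟩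
  simp only [walkOfSteps]
  rw [Fin.sum_univ_eq_sum_range (fun i => if i < k then z (i + 1) - z i else 0) m,
    ← Finset.sum_filter]
  have : (Finset.range m).filter (· < k) = Finset.range k := by
    ext i; simp; omega
  rw [this, Finset.sum_range_sub, h0, sub_zero]

/-- Every path from the origin to a distant point makes many unit crossings around separated
lattice points. -/
theorem exists_separated_walk {d m M : ℕ} {R : ℝ} (hR : (d : ℝ) + 1 ≤ R) (hM : R + d ≤ M)
    {γ : ℝ → Rd d} (hγ : IsPiecewiseC1On γ 0 1) (h0 : γ 0 = 0)
    (h1 : (m + 1) * (R + d) < ‖γ 1‖) :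
    ∃ (e : Fin m → latticeBox d M) (σ : ℕ → ℝ), Monotone σ ∧ (∀ k, σ k ∈ Icc (0 : ℝ) 1) ∧
      (∀ i j : Fin m, i ≠ j →
        R - d ≤ ‖latticePoint (walkOfSteps e i) - latticePoint (walkOfSteps e j)‖) ∧
      ∀ k : Fin m, ‖γ (σ k) - latticePoint (walkOfSteps e k)‖ ≤ d ∧
        d + 1 ≤ ‖γ (σ (k + 1)) - latticePoint (walkOfSteps e k)‖ := by
  have hd : (0 : ℝ) ≤ d := Nat.cast_nonneg d
  obtain ⟨σ, hmono, hσ0, hσ, hstep⟩ := exists_last_visits hγ.1 (R := R) (by linarith)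
  have hrd (k : ℕ) := norm_sub_latticePoint_roundVec_le (γ (σ k))
  have hdist (k : ℕ) : ‖γ (σ k)‖ ≤ k * (R + d) := by
    induction k with
    | zero => simp [hσ0, h0]
    | succ k ih =>
      have e : γ (σ (k + 1)) = (γ (σ (k + 1)) - latticePoint (roundVec (γ (σ k)))) -
          (γ (σ k) - latticePoint (roundVec (γ (σ k)))) + γ (σ k) := by abel
      have := norm_add_le ((γ (σ (k + 1)) - latticePoint (roundVec (γ (σ k)))) -
          (γ (σ k) - latticePoint (roundVec (γ (σ k))))) (γ (σ k))
      rw [← e] at this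
      have h2 := norm_sub_le (γ (σ (k + 1)) - latticePoint (roundVec (γ (σ k))))
          (γ (σ k) - latticePoint (roundVec (γ (σ k))))
      push_cast
      linarith [hrd k, (hstep k).1]
  have hfar (k : ℕ) (hk : k < m) : ∀ s ∈ Icc (σ (k + 1)) 1,
      R ≤ ‖γ s - latticePoint (roundVec (γ (σ k)))‖ := by
    apply (hstep k).2
    have e : γ 1 = (γ 1 - latticePoint (roundVec (γ (σ k)))) -
          (γ (σ k) - latticePoint (roundVec (γ (σ k)))) + γ (σ k) := by abel
    have := norm_add_le ((γ 1 - latticePoint (roundVec (γ (σ k)))) -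
          (γ (σ k) - latticePoint (roundVec (γ (σ k))))) (γ (σ k))
    rw [← e] at this
    have h2 := norm_sub_le (γ 1 - latticePoint (roundVec (γ (σ k))))
          (γ (σ k) - latticePoint (roundVec (γ (σ k))))
    have h3 : (k : ℝ) * (R + d) ≤ m * (R + d) :=
      mul_le_mul_of_nonneg_right (by exact_mod_cast hk.le) (by linarith)
    linarith [hrd k, hdist k]
  obtain ⟨e, he⟩ := exists_walkOfSteps_eq (m := m) (M := M) (fun k => roundVec (γ (σ k)))
    (by funext i; simp [roundVec, hσ0, h0]) (fun k hk => by
      simp only [latticeBox, Fintype.mem_piFinset, Finset.mem_Icc]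
      intro i
      rw [← abs_le]
      have h := abs_coord_sub_le (roundVec (γ (σ (k + 1)))) (roundVec (γ (σ k))) i
      have h2 := norm_sub_le_norm_sub_add_norm_sub (latticePoint (roundVec (γ (σ (k + 1)))))
        (γ (σ (k + 1))) (latticePoint (roundVec (γ (σ k))))
      rw [norm_sub_rev _ (γ (σ (k + 1)))] at h2
      have h3 : (|roundVec (γ (σ (k + 1))) i - roundVec (γ (σ k)) i| : ℝ) ≤ M := by
        linarith [hrd (k + 1), (hstep k).1]
      exact_mod_cast h3)
  refine ⟨e, σ, hmono, hσ, ?_, fun k => ?_⟩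
  · have key (i j : ℕ) (hij : i < j) (hj : j < m) :
        R - d ≤ ‖latticePoint (roundVec (γ (σ j))) - latticePoint (roundVec (γ (σ i)))‖ := by
      have h1 := hfar i (hij.trans hj) (σ j) ⟨hmono hij, (hσ j).2⟩
      have h2 := norm_sub_le_norm_sub_add_norm_sub (γ (σ j)) (latticePoint (roundVec (γ (σ j))))
        (latticePoint (roundVec (γ (σ i))))
      linarith [hrd j]
    intro i j hij
    rw [he i i.2.le, he j j.2.le]
    rcases lt_or_gt_of_ne hij with h | h
    · rw [norm_sub_rev]
      exact key i j h j.2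
    · exact key j i h i.2
  · rw [he k k.2.le]
    exact ⟨hrd k, hR.trans (hfar k k.2 _ ⟨le_rfl, (hσ _).2⟩)⟩

/-- If fewer than half of the boxes around each separated walk are degenerate, then distances
grow linearly. -/
theorem le_Tg_of_forall_walk {d j M : ℕ} {R δ : ℝ} (hR : (d : ℝ) + 1 ≤ R) (hM : R + d ≤ M)
    (hδ : 0 ≤ δ) {g : Rd d → Matrix (Fin d) (Fin d) ℝ} (hg : Continuous g) {y : Rd d}
    (hy : (2 * j + 1) * (R + d) < ‖y‖) (bad : (Fin d → ℤ) → Prop)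
    (hgood : ∀ z, ¬ bad z → ∀ x ∈ ball (latticePoint z) ((d : ℝ) + 1), ∀ u,
      δ * ‖u‖ ^ 2 ≤ quadForm (g x) u)
    (hwalk : ∀ e : Fin (2 * j) → latticeBox d M,
      (∀ i k : Fin (2 * j), i ≠ k →
        R - d ≤ ‖latticePoint (walkOfSteps e i) - latticePoint (walkOfSteps e k)‖) →
      ∀ I : Finset (Fin (2 * j)), j ≤ I.card → ∃ k ∈ I, ¬ bad (walkOfSteps e k)) :
    j * Real.sqrt δ ≤ Tg g 0 y := by
  apply le_csInf (tgSet_nonempty g 0 y)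
  rintro _ ⟨γ, hγ, h0, h1, rfl⟩
  obtain ⟨e, σ, hmono, hσ, hsep, hcross⟩ := exists_separated_walk (m := 2 * j) hR hM hγ h0
    (by rw [h1]; push_cast; exact hy)
  classical
  set I : Finset (Fin (2 * j)) := Finset.univ.filter fun k => bad (walkOfSteps e k) with hI
  have hIcard : I.card < j := by
    by_contra hcon
    obtain ⟨k, hk, hkgood⟩ := hwalk e hsep I (not_lt.1 hcon)
    exact hkgood (Finset.mem_filter.1 hk).2
  have hcompl : j ≤ Iᶜ.card := by
    rw [Finset.card_compl, Fintype.card_fin]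
    omega
  set f : ℝ → ℝ := fun s => Real.sqrt (quadForm (g (γ s)) (deriv γ s)) with hf
  have hfint : IntervalIntegrable f volume 0 1 := hγ.intervalIntegrable_speed hg
  have hsubint {a b : ℝ} (ha : 0 ≤ a) (hab : a ≤ b) (hb : b ≤ 1) :
      IntervalIntegrable f volume a b := by
    refine hfint.mono_set ?_
    rw [uIcc_of_le hab, uIcc_of_le zero_le_one]
    exact Icc_subset_Icc ha hb
  have hnonneg (k : Fin (2 * j)) : 0 ≤ ∫ s in σ k..σ (k + 1), f s :=
    intervalIntegral.integral_nonneg (hmono (Nat.le_succ _)) fun _ _ => Real.sqrt_nonneg _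
  calc (j : ℝ) * Real.sqrt δ ≤ Iᶜ.card * Real.sqrt δ := by gcongr
    _ = ∑ k ∈ Iᶜ, Real.sqrt δ := by rw [Finset.sum_const, nsmul_eq_mul]
    _ ≤ ∑ k ∈ Iᶜ, ∫ s in σ k..σ (k + 1), f s := by
        refine Finset.sum_le_sum fun k hk => ?_
        have hk' : ¬ bad (walkOfSteps e k) := by simpa [hI] using hk
        exact hγ.sqrt_le_integral_speed hg (hσ k).1 (hmono (Nat.le_succ _)) (hσ _).2 hδ
          (hgood _ hk') (hcross k).1 (hcross k).2
    _ ≤ ∑ k : Fin (2 * j), ∫ s in σ k..σ (k + 1), f s :=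
        Finset.sum_le_sum_of_subset_of_nonneg (Finset.subset_univ _) fun k _ _ => hnonneg k
    _ = ∑ k ∈ Finset.range (2 * j), ∫ s in σ k..σ (k + 1), f s :=
        Fin.sum_univ_eq_sum_range (fun k => ∫ s in σ k..σ (k + 1), f s) (2 * j)
    _ = ∫ s in σ 0..σ (2 * j), f s :=
        intervalIntegral.sum_integral_adjacent_intervals fun k _ =>
          hsubint (hσ k).1 (hmono (Nat.le_succ _)) (hσ _).2
    _ ≤ ∫ s in (0 : ℝ)..1, f s :=
        intervalIntegral.integral_mono_interval (hσ 0).1 (hmono (Nat.zero_le _)) (hσ _).2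
          (Eventually.of_forall fun _ => Real.sqrt_nonneg _) hfint
    _ = gLength g γ := rfl

/-- Metrics failing the lower bound `g ≥ δ` somewhere on the ball of radius `d + 1`, tested on
countable dense sets of points and directions. -/
def degenerateMetrics (d : ℕ) (δ : ℝ) : Set (Rd d → Matrix (Fin d) (Fin d) ℝ) :=
  {h | ∃ m n : ℕ, TopologicalSpace.denseSeq (Rd d) m ∈ ball (0 : Rd d) ((d : ℝ) + 1) ∧
    quadForm (h (TopologicalSpace.denseSeq (Rd d) m)) (TopologicalSpace.denseSeq (Rd d) n) <
      δ * ‖TopologicalSpace.denseSeq (Rd d) n‖ ^ 2}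

theorem measurable_quadForm {d : ℕ} (u : Rd d) :
    Measurable fun A : Matrix (Fin d) (Fin d) ℝ => quadForm A u := by
  simp only [quadForm_eq_sum]
  have hA (i j : Fin d) : Measurable fun A : Matrix (Fin d) (Fin d) ℝ => A i j :=
    (measurable_pi_apply (X := fun _ : Fin d => ℝ) j).comp
      (measurable_pi_apply (X := fun _ : Fin d => Fin d → ℝ) i)
  exact Finset.measurable_sum _ fun i _ => (Finset.measurable_sum _ fun j _ =>
    (hA i j).mul_const _).mul_const _

theorem measurableSet_mem_degenerateMetrics {d : ℕ} {α : Type*} [MeasurableSpace α]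
    {f : α → Rd d → Matrix (Fin d) (Fin d) ℝ} {δ : ℝ}
    (hf : ∀ x ∈ ball (0 : Rd d) ((d : ℝ) + 1), Measurable fun a => f a x) :
    MeasurableSet {a | f a ∈ degenerateMetrics d δ} := by
  have heq : {a | f a ∈ degenerateMetrics d δ} = ⋃ (m : ℕ) (n : ℕ),
      {a | TopologicalSpace.denseSeq (Rd d) m ∈ ball (0 : Rd d) ((d : ℝ) + 1) ∧
        quadForm (f a (TopologicalSpace.denseSeq (Rd d) m)) (TopologicalSpace.denseSeq (Rd d) n) <
          δ * ‖TopologicalSpace.denseSeq (Rd d) n‖ ^ 2} := by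
    ext a
    simp only [mem_iUnion]
    rfl
  rw [heq]
  refine MeasurableSet.iUnion fun m => MeasurableSet.iUnion fun n => ?_
  by_cases hm : TopologicalSpace.denseSeq (Rd d) m ∈ ball (0 : Rd d) ((d : ℝ) + 1)
  · simp only [hm, true_and]
    exact measurableSet_lt ((measurable_quadForm _).comp (hf _ hm)) measurable_const
  · simp [hm]

theorem le_quadForm_of_notMem_degenerateMetrics {d : ℕ} {δ : ℝ}
    {h : Rd d → Matrix (Fin d) (Fin d) ℝ} (hh : Continuous h) (hδ : h ∉ degenerateMetrics d δ)
    {x : Rd d} (hx : x ∈ ball (0 : Rd d) ((d : ℝ) + 1)) (u : Rd d) :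
    δ * ‖u‖ ^ 2 ≤ quadForm (h x) u := by
  by_contra! hcon
  have hopen : IsOpen {p : Rd d × Rd d | p.1 ∈ ball (0 : Rd d) ((d : ℝ) + 1) ∧
      quadForm (h p.1) p.2 < δ * ‖p.2‖ ^ 2} :=
    (isOpen_ball.preimage continuous_fst).inter (isOpen_lt
      (continuous_quadForm.comp ((hh.comp continuous_fst).prodMk continuous_snd)) (by fun_prop))
  have hdense := (TopologicalSpace.denseRange_denseSeq (Rd d)).prodMap
    (TopologicalSpace.denseRange_denseSeq (Rd d))
  obtain ⟨⟨m, n⟩, hmn⟩ := hdense.exists_mem_open hopen ⟨(x, u), hx, hcon⟩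
  exact hδ ⟨m, n, hmn.1, hmn.2⟩

theorem exists_notMem_degenerateMetrics {d : ℕ} {h : Rd d → Matrix (Fin d) (Fin d) ℝ}
    (hh : Continuous h) (hpos : ∀ x, (h x).PosDef) :
    ∃ δ > 0, h ∉ degenerateMetrics d δ := by
  have hcont : Continuous fun p : Rd d × Rd d => quadForm (h p.1) p.2 :=
    continuous_quadForm.comp ((hh.comp continuous_fst).prodMk continuous_snd)
  obtain ⟨δ, hδ, hle⟩ := ((isCompact_closedBall (0 : Rd d) ((d : ℝ) + 1)).prod
    (isCompact_sphere (0 : Rd d) 1)).exists_forall_le' hcont.continuousOn (a := 0)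
    (fun p hp => quadForm_pos (hpos p.1) (ne_of_mem_sphere hp.2 one_ne_zero))
  refine ⟨δ, hδ, ?_⟩
  rintro ⟨m, n, hm, hn⟩
  set u := TopologicalSpace.denseSeq (Rd d) n
  rcases eq_or_ne u 0 with hu | hu
  · simp [hu, quadForm_eq_sum] at hn
  · have hu' : 0 < ‖u‖ := norm_pos_iff.2 hu
    have h1 := hle (TopologicalSpace.denseSeq (Rd d) m, ‖u‖⁻¹ • u)
      ⟨ball_subset_closedBall hm, by simp [norm_smul, hu'.ne']⟩
    simp only [quadForm_smul] at h1
    have h2 := mul_le_mul_of_nonneg_right h1 (sq_nonneg ‖u‖)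
    have h3 : ‖u‖⁻¹ ^ 2 * quadForm (h (TopologicalSpace.denseSeq (Rd d) m)) u * ‖u‖ ^ 2 =
        quadForm (h (TopologicalSpace.denseSeq (Rd d) m)) u := by
      field_simp
    linarith

theorem degenerateMetrics_mono {d : ℕ} {δ δ' : ℝ} (h : δ ≤ δ') :
    degenerateMetrics d δ ⊆ degenerateMetrics d δ' := by
  rintro f ⟨m, n, hm, hn⟩
  exact ⟨m, n, hm, hn.trans_le (mul_le_mul_of_nonneg_right h (sq_nonneg _))⟩

theorem exists_measure_degenerateMetrics_le {d : ℕ} (P : Measure Ω) [IsProbabilityMeasure P]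
    {g : Ω → Rd d → Matrix (Fin d) (Fin d) ℝ} (hcont : ∀ ω, Continuous (g ω))
    (hpos : ∀ ω x, (g ω x).PosDef) (hmeasg : ∀ x : Rd d, Measurable fun ω => g ω x)
    {ε : ENNReal} (hε : 0 < ε) :
    ∃ δ > 0, P {ω | g ω ∈ degenerateMetrics d δ} ≤ ε := by
  have hlim := tendsto_measure_iInter_atTop (μ := P)
    (s := fun n : ℕ => {ω | g ω ∈ degenerateMetrics d (1 / ((n : ℝ) + 1))})
    (fun n => (measurableSet_mem_degenerateMetrics fun x _ => hmeasg x).nullMeasurableSet)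
    (fun m n hmn ω hω => degenerateMetrics_mono (Nat.one_div_le_one_div hmn) hω)
    ⟨0, measure_ne_top _ _⟩
  have hempty : ⋂ n : ℕ, {ω | g ω ∈ degenerateMetrics d (1 / ((n : ℝ) + 1))} = ∅ := by
    refine eq_empty_of_forall_notMem fun ω hω => ?_
    obtain ⟨δ, hδ, hnot⟩ := exists_notMem_degenerateMetrics (hcont ω) (hpos ω)
    obtain ⟨n, hn⟩ := exists_nat_one_div_lt hδ
    exact hnot (degenerateMetrics_mono hn.le (mem_iInter.1 hω n))
  rw [hempty, measure_empty] at hlim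
  obtain ⟨n, hn⟩ := (hlim.eventually (ge_mem_nhds hε)).exists
  exact ⟨1 / ((n : ℝ) + 1), Nat.one_div_pos_of_nat, hn⟩

/-- The event that the metric is degenerate near the point `c`. -/
def degenerateEvent {d : ℕ} (g : Ω → Rd d → Matrix (Fin d) (Fin d) ℝ) (δ : ℝ) (c : Rd d) :
    Set Ω :=
  {ω | shiftG c (g ω) ∈ degenerateMetrics d δ}

theorem ErgodicMetric.measure_degenerateEvent {d : ℕ} {P : Measure Ω}
    {g : Ω → Rd d → Matrix (Fin d) (Fin d) ℝ} (herg : ErgodicMetric P g)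
    (hmeasg : ∀ x : Rd d, Measurable fun ω => g ω x) (δ : ℝ) (c : Rd d) :
    P (degenerateEvent g δ c) = P {ω | g ω ∈ degenerateMetrics d δ} := by
  rcases eq_or_ne c 0 with rfl | hc
  · have h0 (ω : Ω) : shiftG 0 (g ω) = g ω := funext fun x => congrArg (g ω) (zero_add x)
    simp only [degenerateEvent, h0]
  · have hB : MeasurableSet (degenerateMetrics d δ) :=
      measurableSet_mem_degenerateMetrics (f := fun h => h) fun x _ => measurable_pi_apply x
    have h := congrArg (fun ν => ν (degenerateMetrics d δ)) (herg c hc).1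
    exact (Measure.map_apply (measurable_pi_lambda _ fun x => hmeasg (c + x)) hB).symm.trans
      (h.trans (Measure.map_apply (measurable_pi_lambda _ hmeasg) hB))

/-- The `σ`-algebra generated by the metric on a set `A`. -/
abbrev metricSigma {d : ℕ} (g : Ω → Rd d → Matrix (Fin d) (Fin d) ℝ) (A : Set (Rd d)) :
    MeasurableSpace Ω :=
  ⨆ x ∈ A, MeasurableSpace.comap (fun ω => g ω x) inferInstance

theorem metricSigma_mono {d : ℕ} (g : Ω → Rd d → Matrix (Fin d) (Fin d) ℝ) {A B : Set (Rd d)}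
    (h : A ⊆ B) : metricSigma g A ≤ metricSigma g B :=
  biSup_mono h

theorem measurableSet_degenerateEvent {d : ℕ} (g : Ω → Rd d → Matrix (Fin d) (Fin d) ℝ) (δ : ℝ)
    (c : Rd d) :
    MeasurableSet[metricSigma g (ball c ((d : ℝ) + 1))] (degenerateEvent g δ c) := by
  refine @measurableSet_mem_degenerateMetrics d Ω (metricSigma g (ball c ((d : ℝ) + 1)))
    (fun ω => shiftG c (g ω)) δ fun x hx => ?_
  rw [measurable_iff_comap_le]
  have hmem : c + x ∈ ball c ((d : ℝ) + 1) := by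
    rw [mem_ball_zero_iff] at hx
    simpa using hx
  exact le_biSup (fun x => MeasurableSpace.comap (fun ω => g ω x) inferInstance) hmem

theorem measure_iInter_degenerateEvent {d : ℕ} {P : Measure Ω} [IsProbabilityMeasure P]
    {g : Ω → Rd d → Matrix (Fin d) (Fin d) ℝ} (herg : ErgodicMetric P g)
    (hmeasg : ∀ x : Rd d, Measurable fun ω => g ω x) {Q : ℝ}
    (hFR : ∀ A B : Set (Rd d), Q ≤ setDist A B →
      ProbabilityTheory.Indep (metricSigma g A) (metricSigma g B) P)
    (δ : ℝ) {ι : Type*} (c : ι → Rd d)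
    (hsep : ∀ i j, i ≠ j → Q + 2 * ((d : ℝ) + 1) ≤ ‖c i - c j‖) (I : Finset ι) :
    P (⋂ i ∈ I, degenerateEvent g δ (c i)) =
      P {ω | g ω ∈ degenerateMetrics d δ} ^ I.card := by
  classical
  induction I using Finset.induction_on with
  | empty => simp
  | insert i I hi ih =>
    rw [Finset.set_biInter_insert, Finset.card_insert_of_notMem hi]
    rcases I.eq_empty_or_nonempty with rfl | hne
    · simp [herg.measure_degenerateEvent hmeasg]
    · have hd : (0 : ℝ) < (d : ℝ) + 1 := by positivity
      have hdist : Q ≤ setDist (ball (c i) ((d : ℝ) + 1))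
          (⋃ k ∈ I, ball (c k) ((d : ℝ) + 1)) := by
        apply le_csInf
        · obtain ⟨k, hk⟩ := hne
          exact ⟨_, (c i, c k), ⟨mem_ball_self hd,
            mem_biUnion hk (mem_ball_self hd)⟩, rfl⟩
        · rintro _ ⟨⟨x, y⟩, ⟨hx, hy⟩, rfl⟩
          simp only [mem_iUnion, exists_prop] at hy
          obtain ⟨k, hk, hy⟩ := hy
          have hik : i ≠ k := fun h => hi (h ▸ hk)
          have h1 := hsep i k hik
          rw [← dist_eq_norm] at h1
          have h2 := dist_triangle4 (c i) x y (c k)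
          simp only [mem_ball] at hx hy
          rw [dist_comm] at hx
          show Q ≤ dist x y
          linarith
      rw [(ProbabilityTheory.Indep_iff _ _ _).1 (hFR _ _ hdist) _ _
        (measurableSet_degenerateEvent g δ (c i))
        (Finset.measurableSet_biInter I fun k hk =>
          metricSigma_mono g (subset_biUnion_of_mem (u := fun k => ball (c k) ((d : ℝ) + 1)) hk) _
            (measurableSet_degenerateEvent g δ (c k))),
        ih, herg.measure_degenerateEvent hmeasg, pow_succ']

/-- The event that some separated walk meets many degenerate boxes. -/
def manyDegenerate {d : ℕ} (g : Ω → Rd d → Matrix (Fin d) (Fin d) ℝ) (δ R : ℝ) (j M : ℕ) :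
    Set Ω :=
  ⋃ (e : Fin (2 * j) → latticeBox d M)
    (_ : ∀ i k : Fin (2 * j), i ≠ k →
      R - d ≤ ‖latticePoint (walkOfSteps e i) - latticePoint (walkOfSteps e k)‖)
    (I : Finset (Fin (2 * j))) (_ : j ≤ I.card),
    ⋂ k ∈ I, degenerateEvent g δ (latticePoint (walkOfSteps e k))

theorem measure_iUnion_le_of_forall_le {P : Measure Ω} {p : Prop} {s : p → Set Ω} {b : ENNReal}
    (h : ∀ hp, P (s hp) ≤ b) : P (⋃ hp, s hp) ≤ b := by
  by_cases hp : p
  · exact (measure_mono (iUnion_subset fun _ => subset_rfl)).trans (h hp)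
  · rw [eq_empty_of_forall_notMem fun ω hω => hp (mem_iUnion.1 hω).choose, measure_empty]
    exact zero_le

theorem measure_manyDegenerate_le {d : ℕ} {P : Measure Ω} [IsProbabilityMeasure P]
    {g : Ω → Rd d → Matrix (Fin d) (Fin d) ℝ} (herg : ErgodicMetric P g)
    (hmeasg : ∀ x : Rd d, Measurable fun ω => g ω x) {Q : ℝ}
    (hFR : ∀ A B : Set (Rd d), Q ≤ setDist A B →
      ProbabilityTheory.Indep (metricSigma g A) (metricSigma g B) P)
    (δ : ℝ) {R : ℝ} (hR : Q + 2 * ((d : ℝ) + 1) ≤ R - d) (j M : ℕ) :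
    P (manyDegenerate g δ R j M) ≤
      (4 * ((latticeBox d M).card : ENNReal) ^ 2 * P {ω | g ω ∈ degenerateMetrics d δ}) ^ j := by
  set p := P {ω | g ω ∈ degenerateMetrics d δ} with hp
  have hsingle (e : Fin (2 * j) → latticeBox d M)
      (he : ∀ i k : Fin (2 * j), i ≠ k →
        R - d ≤ ‖latticePoint (walkOfSteps e i) - latticePoint (walkOfSteps e k)‖)
      (I : Finset (Fin (2 * j))) (hI : j ≤ I.card) :
      P (⋂ k ∈ I, degenerateEvent g δ (latticePoint (walkOfSteps e k))) ≤ p ^ j := by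
    rw [measure_iInter_degenerateEvent herg hmeasg hFR δ
      (fun k : Fin (2 * j) => latticePoint (walkOfSteps e k))
      (fun i k hik => hR.trans (he i k hik)) I]
    exact pow_le_pow_right_of_le_one' prob_le_one hI
  calc P (manyDegenerate g δ R j M)
      ≤ ∑ _e : Fin (2 * j) → latticeBox d M, ∑ _I : Finset (Fin (2 * j)), p ^ j := by
        refine (measure_iUnion_fintype_le P _).trans (Finset.sum_le_sum fun e _ => ?_)
        refine (measure_iUnion_le_of_forall_le fun he => ?_)
        refine (measure_iUnion_fintype_le P _).trans (Finset.sum_le_sum fun I _ => ?_)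
        exact measure_iUnion_le_of_forall_le fun hI => hsingle e he I hI
    _ = (4 * ((latticeBox d M).card : ENNReal) ^ 2 * p) ^ j := by
        simp only [Finset.sum_const, Finset.card_univ, Fintype.card_fun, Fintype.card_fin,
          Fintype.card_coe, Fintype.card_finset, nsmul_eq_mul, mul_pow, pow_mul]
        push_cast
        ring

theorem le_Tg_of_notMem_manyDegenerate {d j M : ℕ} {R δ : ℝ} (hR : (d : ℝ) + 1 ≤ R)
    (hM : R + d ≤ M) (hδ : 0 ≤ δ) {g : Ω → Rd d → Matrix (Fin d) (Fin d) ℝ} {ω : Ω}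
    (hg : Continuous (g ω)) {y : Rd d} (hy : (2 * j + 1) * (R + d) < ‖y‖)
    (hω : ω ∉ manyDegenerate g δ R j M) :
    j * Real.sqrt δ ≤ Tg (g ω) 0 y := by
  refine le_Tg_of_forall_walk hR hM hδ hg hy
    (fun z => ω ∈ degenerateEvent g δ (latticePoint z)) ?_ ?_
  · intro z hz x hx u
    have h := le_quadForm_of_notMem_degenerateMetrics (x := x - latticePoint z)
      (hg.comp (continuous_const.add continuous_id)) hz
      (by rw [mem_ball_zero_iff]; rwa [mem_ball_iff_norm] at hx) u
    simpa using h
  · intro e he I hI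
    simp only [manyDegenerate, mem_iUnion, not_exists] at hω
    have := hω e he I hI
    simpa only [mem_iInter, not_forall, exists_prop] using this

/-- For an ergodic random continuous Riemannian metric with the weak finite
moment condition and finite range of dependence, the time constant is a norm. -/
theorem stmt_16 (d : ℕ) (hd : 1 ≤ d) {Ω : Type} [MeasurableSpace Ω]
    (P : Measure Ω) [IsProbabilityMeasure P] (g : Ω → Rd d → Matrix (Fin d) (Fin d) ℝ)
    (hcont : ∀ ω, Continuous (g ω))
    (hpos : ∀ ω x, (g ω x).PosDef)
    (hmeasg : ∀ x : Rd d, Measurable fun ω => g ω x)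
    (hTmeas : ∀ x y : Rd d, Measurable fun ω => Tg (g ω) x y)
    (hAnnMeas : ∀ r R : ℝ, 0 < r → r < R → Measurable fun ω => TgAnn (g ω) r R)
    (herg : ErgodicMetric P g) (hmom : WeakFiniteMoment P g)
    (hFR : ∃ Q : ℝ, 0 < Q ∧ ∀ A B : Set (Rd d), Q ≤ setDist A B →
      ProbabilityTheory.Indep
        (⨆ x ∈ A, MeasurableSpace.comap (fun ω => g ω x) inferInstance)
        (⨆ y ∈ B, MeasurableSpace.comap (fun ω => g ω y) inferInstance) P)
    (μ : Rd d → ℝ) (hμ : IsTimeConstantG P g μ) :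
    ∀ v : Rd d, v ≠ 0 → 0 < μ v := by
  obtain ⟨Q, hQ, hFR⟩ := hFR
  intro v hv
  by_contra hcon
  have hμv : μ v = 0 := le_antisymm (not_lt.1 hcon) (hμ.1 v)
  have hv' : 0 < ‖v‖ := norm_pos_iff.2 hv
  have hd0 : (0 : ℝ) ≤ d := Nat.cast_nonneg d
  set R : ℝ := Q + 2 * ((d : ℝ) + 1) + d with hRdef
  obtain ⟨M, hM⟩ := exists_nat_ge (R + d)
  obtain ⟨K, hK⟩ := exists_nat_gt ((R + d) / ‖v‖)
  rw [div_lt_iff₀ hv'] at hK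
  have hRpos : 0 < R + d := by linarith
  have hKpos : (0 : ℝ) < K := by
    by_contra h
    nlinarith
  set L : ENNReal := 4 * ((latticeBox d M).card : ENNReal) ^ 2 with hL
  have hLtop : L ≠ ⊤ := by simp [hL, ENNReal.mul_eq_top]
  obtain ⟨δ, hδ, hp⟩ := exists_measure_degenerateMetrics_le P hcont hpos hmeasg
    (ε := 2⁻¹ / L) (ENNReal.div_pos (by simp) hLtop)
  have hhalf : L * P {ω | g ω ∈ degenerateMetrics d δ} ≤ 2⁻¹ :=
    (mul_le_mul_right hp L).trans ENNReal.mul_div_le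
  set ε : ℝ := Real.sqrt δ / (3 * K) with hε
  have hεpos : 0 < ε := by
    have := Real.sqrt_pos.2 hδ
    positivity
  have hmeasure : TendstoInMeasure P
      (fun (n : ℕ) ω => Tg (g ω) 0 ((n : ℝ) • v) / n) atTop (fun _ => 0) :=
    tendstoInMeasure_of_tendsto_ae
      (fun n => ((hTmeas 0 ((n : ℝ) • v)).div_const _).aestronglyMeasurable)
      (by simpa only [hμv] using (hμ.2.2.2 v).1)
  have hsub : Tendsto (fun j : ℕ => K * (2 * j + 1)) atTop atTop := by
    refine tendsto_atTop_mono (fun j => ?_) tendsto_id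
    have : 1 ≤ K := by exact_mod_cast hKpos
    show j ≤ K * (2 * j + 1)
    nlinarith
  have hlim := ((tendstoInMeasure_iff_dist.1 hmeasure ε hεpos).comp hsub).eventually
    (gt_mem_nhds (show (0 : ENNReal) < 2⁻¹ by simp))
  obtain ⟨j, hj, hj1⟩ := (hlim.and (eventually_ge_atTop 1)).exists
  simp only [Function.comp_apply] at hj
  have hbad : P (manyDegenerate g δ R j M) ≤ 2⁻¹ := by
    refine (measure_manyDegenerate_le herg hmeasg hFR δ (by linarith) j M).trans ?_
    refine (pow_le_pow_left' hhalf j).trans ?_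
    exact (pow_le_pow_right_of_le_one' (by simp) hj1).trans (pow_one _).le
  have hcover : (univ : Set Ω) ⊆ manyDegenerate g δ R j M ∪
      {ω | ε ≤ dist (Tg (g ω) 0 (((K * (2 * j + 1) : ℕ) : ℝ) • v) /
        ((K * (2 * j + 1) : ℕ) : ℝ)) 0} := by
    intro ω _
    by_cases hω : ω ∈ manyDegenerate g δ R j M
    · exact Or.inl hω
    · right
      have hj0 : (1 : ℝ) ≤ j := by exact_mod_cast hj1
      have h := le_Tg_of_notMem_manyDegenerate (y := ((K * (2 * j + 1) : ℕ) : ℝ) • v)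
        (by linarith) hM hδ.le (hcont ω) (by
          rw [norm_smul, Real.norm_natCast]
          push_cast
          nlinarith) hω
      rw [mem_ofPred_eq, Real.dist_eq, sub_zero]
      refine le_trans ?_ (le_abs_self _)
      rw [hε]
      push_cast at h ⊢
      rw [div_le_div_iff₀ (by positivity) (by positivity)]
      have h2 : Real.sqrt δ * (K * (2 * j + 1)) ≤ j * Real.sqrt δ * (3 * K) := by
        have : 0 ≤ Real.sqrt δ * K := by positivity
        nlinarith
      exact h2.trans (mul_le_mul_of_nonneg_right h (by positivity))
  have hone := (measure_mono (μ := P) hcover).trans (measure_union_le _ _)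
  rw [measure_univ] at hone
  have hlt := ENNReal.add_lt_add_of_le_of_lt (by simp) hbad hj
  rw [ENNReal.inv_two_add_inv_two] at hlt
  exact absurd hone hlt.not_ge
end
end
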